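/- arXiv:2211.07464 — 5 statements merged into one kernel-verified Lean document; each statement's English description precedes it below -/
import Mathlib

section
/- (Maximum principle for inversive distance circle packings.) Let r = (r₀, r₁, …, r_n) and r̄ = (r̄₀, r̄₁, …, r̄_n) be two generalized weighted Delaunay inversive distance circle packings on the star triangulation of an n-gon with the same weights I(e) > 1. If the curvatures at the interior vertex satisfy K₀(r) ≤ K₀(r̄), and max{ r_i/r̄_i : i = 1, …, n } ≤ r₀/r̄₀, then there exists a constant c > 0 such that r_a = c · r̄_a for all a = 0, 1, …, n. -/
/-- Inversive distance edge length for radii `a, b` and weight `I` on the edge. -/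
noncomputable def lenr (I a b : ℝ) : ℝ :=
  Real.sqrt (a ^ 2 + b ^ 2 + 2 * a * b * I)

/-- Inner angle opposite the side of length `c` in a (generalized) triangle with
adjacent side lengths `a, b`. -/
noncomputable def ang0 (a b c : ℝ) : ℝ :=
  Real.arccos ((a ^ 2 + b ^ 2 - c ^ 2) / (2 * a * b))

/-- Length of the spoke edge `v₀vᵢ` in the star triangulation: `I0 i` is the weight
on `v₀vᵢ`, `r0` the radius at `v₀` and `r i` the radius at `vᵢ`. -/
noncomputable def spoke {n : ℕ} (I0 : Fin n → ℝ) (r0 : ℝ) (r : Fin n → ℝ) (i : Fin n) : ℝ :=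
  lenr (I0 i) r0 (r i)

/-- Length of the boundary edge `vᵢv_{i+1}` (indices mod `n`): `Ib i` is the weight on it. -/
noncomputable def bd {n : ℕ} [NeZero n] (Ib : Fin n → ℝ) (r : Fin n → ℝ) (i : Fin n) : ℝ :=
  lenr (Ib i) (r i) (r (i + 1))

/-- `(r0, r)` is a generalized inversive distance circle packing on the star
triangulation: each triangle `v₀vᵢv_{i+1}` satisfies the non-strict triangle
inequalities. -/
def genPacking {n : ℕ} [NeZero n] (I0 Ib : Fin n → ℝ) (r0 : ℝ) (r : Fin n → ℝ) : Prop :=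
  ∀ i : Fin n,
    spoke I0 r0 r i ≤ spoke I0 r0 r (i + 1) + bd Ib r i ∧
    spoke I0 r0 r (i + 1) ≤ spoke I0 r0 r i + bd Ib r i ∧
    bd Ib r i ≤ spoke I0 r0 r i + spoke I0 r0 r (i + 1)

/-- Combinatorial curvature at the interior vertex `v₀`: `2π` minus the sum of the
angles at `v₀` of the triangles `v₀vᵢv_{i+1}`. -/
noncomputable def curv0 {n : ℕ} [NeZero n] (I0 Ib : Fin n → ℝ) (r0 : ℝ) (r : Fin n → ℝ) : ℝ :=
  2 * Real.pi - ∑ i : Fin n, ang0 (spoke I0 r0 r i) (spoke I0 r0 r (i + 1)) (bd Ib r i)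

/-- Signed distance `d₀ᵢ = (r₀² + r₀rᵢ I(v₀vᵢ))/l₀ᵢ` of the geometric center of the
edge `v₀vᵢ` to `v₀`. -/
noncomputable def dcen {n : ℕ} (I0 : Fin n → ℝ) (r0 : ℝ) (r : Fin n → ℝ) (i : Fin n) : ℝ :=
  (r0 ^ 2 + r0 * r i * I0 i) / spoke I0 r0 r i

/-- Extended signed angle `θ₀ᵢ,ₖ` at the edge `v₀vᵢ` inside the triangle `v₀vᵢvₖ`:
here `a = l₀ᵢ`, `b = l₀ₖ`, `c = lᵢₖ`, `di = d₀ᵢ`, `dk = d₀ₖ`. If the triangle is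
non-degenerate it is `arctan(h₀ᵢ,ₖ/d₀ᵢ)` with `h₀ᵢ,ₖ = (d₀ₖ − d₀ᵢ cos α)/sin α`
and `α` the angle at `v₀`; if it is degenerate it is `−π/2` when `vₖ` is the flat
vertex (`a = b + c`) and `π/2` when `v₀` or `vᵢ` is the flat vertex. -/
noncomputable def thetaEdge (a b c di dk : ℝ) : ℝ :=
  if a < b + c ∧ b < a + c ∧ c < a + b then
    Real.arctan (((dk - di * Real.cos (ang0 a b c)) / Real.sin (ang0 a b c)) / di)
  else if a = b + c then -(Real.pi / 2)
  else Real.pi / 2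

/-- The weighted Delaunay condition: `θ₀ᵢ,ᵢ₋₁ + θ₀ᵢ,ᵢ₊₁ ≥ 0` for every spoke edge. -/
def isDelaunay {n : ℕ} [NeZero n] (I0 Ib : Fin n → ℝ) (r0 : ℝ) (r : Fin n → ℝ) : Prop :=
  ∀ i : Fin n,
    0 ≤ thetaEdge (spoke I0 r0 r i) (spoke I0 r0 r (i - 1)) (bd Ib r (i - 1))
          (dcen I0 r0 r i) (dcen I0 r0 r (i - 1)) +
        thetaEdge (spoke I0 r0 r i) (spoke I0 r0 r (i + 1)) (bd Ib r i)
          (dcen I0 r0 r i) (dcen I0 r0 r (i + 1))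

/-- Minus the Gram determinant of a hyperbolic triangle whose sides have hyperbolic cosines
`C, f, g`. -/
noncomputable def hypGram (C f g : ℝ) : ℝ := 1 - C ^ 2 + 2 * C * f * g - f ^ 2 - g ^ 2

/-- Angle of a hyperbolic triangle opposite the side with hyperbolic cosine `C`, where the adjacent
sides have hyperbolic cosines `f, g`. -/
noncomputable def hypAngle (C f g : ℝ) : ℝ :=
  Real.arccos ((f * g - C) / (√(f ^ 2 - 1) * √(g ^ 2 - 1)))

/-- For a hyperbolic triangle with sides of hyperbolic cosines `C, f, g`, the cosine of the angle
between the sides `f` and `C`, multiplied by the hyperbolic sine of the side `f`. -/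
noncomputable def hypSlope (C f g : ℝ) : ℝ := (C * f - g) / √(C ^ 2 - 1)

/-- Hyperbolic cosine of the distance that represents a spoke of weight `I` and radius ratio `x` in
the hyperbolic link of the central circle. -/
noncomputable def spokeCosh (I x : ℝ) : ℝ := (x + I) / √(I ^ 2 - 1)

/-- Hyperbolic cosine of the side that represents a boundary edge of weight `K`, between spokes of
weights `I` and `J`, in the hyperbolic link of the central circle. -/
noncomputable def edgeCosh (I J K : ℝ) : ℝ := (K + I * J) / (√(I ^ 2 - 1) * √(J ^ 2 - 1))

lemma hypGram_comm (C f g : ℝ) : hypGram C f g = hypGram C g f := by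
  unfold hypGram; ring

lemma sqrt_sq_sub_one_pos {x : ℝ} (hx : 1 < x) : 0 < √(x ^ 2 - 1) :=
  Real.sqrt_pos.2 (by nlinarith)

lemma sq_sqrt_sq_sub_one {x : ℝ} (hx : 1 < x) : √(x ^ 2 - 1) ^ 2 = x ^ 2 - 1 :=
  Real.sq_sqrt (by nlinarith)

lemma one_lt_spokeCosh {I x : ℝ} (hI : 1 < I) (hx : 0 < x) : 1 < spokeCosh I x := by
  have hs := sqrt_sq_sub_one_pos hI
  have hs2 := sq_sqrt_sq_sub_one hI
  rw [spokeCosh, one_lt_div hs]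
  nlinarith

lemma edgeCosh_comm (I J K : ℝ) : edgeCosh I J K = edgeCosh J I K := by
  unfold edgeCosh; rw [mul_comm I J, mul_comm (√_) (√_)]

lemma one_lt_edgeCosh {I J K : ℝ} (hI : 1 < I) (hJ : 1 < J) (hK : 1 < K) :
    1 < edgeCosh I J K := by
  have hs := sqrt_sq_sub_one_pos hI
  have ht := sqrt_sq_sub_one_pos hJ
  have hs2 := sq_sqrt_sq_sub_one hI
  have ht2 := sq_sqrt_sq_sub_one hJ
  rw [edgeCosh, one_lt_div (mul_pos hs ht)]
  have h : √(I ^ 2 - 1) * √(J ^ 2 - 1) < I * J :=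
    mul_lt_mul'' (by nlinarith) (by nlinarith) hs.le ht.le
  linarith

lemma hypSlope_sq_add {C f g : ℝ} (hC : 1 < C) :
    hypSlope C f g ^ 2 + hypGram C f g / (C ^ 2 - 1) = f ^ 2 - 1 := by
  have h : C ^ 2 - 1 ≠ 0 := by nlinarith
  rw [hypSlope, div_pow, sq_sqrt_sq_sub_one hC, hypGram]
  field_simp
  ring

/-- The set of side pairs satisfying the hyperbolic triangle inequalities is strictly convex. -/
lemma hypGram_pos_of_between {C f g f' g' t : ℝ} (hC : 1 < C) (hf : 1 < f) (hf' : 1 < f')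
    (h : 0 ≤ hypGram C f g) (h' : 0 ≤ hypGram C f' g') (hne : f ≠ f' ∨ g ≠ g')
    (ht0 : 0 < t) (ht1 : t < 1) :
    0 < hypGram C (f + t * (f' - f)) (g + t * (g' - g)) := by
  have hs := sqrt_sq_sub_one_pos hC
  have hs2 := sq_sqrt_sq_sub_one hC
  have hC2 : 0 < C ^ 2 - 1 := by nlinarith
  have e := hypSlope_sq_add (f := f) (g := g) hC
  have e' := hypSlope_sq_add (f := f') (g := g') hC
  have d := div_nonneg h hC2.le
  have d' := div_nonneg h' hC2.le
  have et := hypSlope_sq_add (f := f + t * (f' - f)) (g := g + t * (g' - g)) hC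
  have lin : hypSlope C (f + t * (f' - f)) (g + t * (g' - g)) =
      hypSlope C f g + t * (hypSlope C f' g' - hypSlope C f g) := by
    unfold hypSlope; field_simp; ring
  have hne2 : f ≠ f' ∨ hypSlope C f g ≠ hypSlope C f' g' := by
    by_cases hff : f = f'
    · right
      intro hy
      unfold hypSlope at hy
      rw [div_left_inj' hs.ne', hff] at hy
      rcases hne with h1 | h1
      · exact h1 hff
      · exact h1 (by linarith)
    · exact Or.inl hff
  rw [lin] at et
  generalize hypSlope C f g = y at *
  generalize hypSlope C f' g' = y' at *
  have key : 1 + y * y' < f * f' := by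
    by_cases hy : y = y'
    · subst hy
      rcases hne2 with h1 | h1
      · rcases lt_or_gt_of_ne h1 with h2 | h2 <;> nlinarith
      · exact absurd rfl h1
    · have : (1 + y * y') ^ 2 < (f * f') ^ 2 := by
        have h3 : 0 < (y - y') ^ 2 := by positivity
        have h4 : (1 + y ^ 2) * (1 + y' ^ 2) ≤ f ^ 2 * f' ^ 2 :=
          mul_le_mul (by linarith) (by linarith) (by positivity) (by positivity)
        nlinarith
      exact lt_of_pow_lt_pow_left₀ 2 (by positivity) this
  have : 0 < hypGram C (f + t * (f' - f)) (g + t * (g' - g)) / (C ^ 2 - 1) := by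
    have h1 : 0 ≤ (1 - t) ^ 2 * (f ^ 2 - 1 - y ^ 2) := mul_nonneg (by positivity) (by linarith)
    have h2 : 0 ≤ t ^ 2 * (f' ^ 2 - 1 - y' ^ 2) := mul_nonneg (by positivity) (by linarith)
    have h3 : 0 < t * (1 - t) * (f * f' - (1 + y * y')) :=
      mul_pos (mul_pos ht0 (by linarith)) (by linarith)
    nlinarith
  exact (div_pos_iff_of_pos_right hC2).1 this

lemma one_sub_cos_sq {C f g : ℝ} (hf : 1 < f) (hg : 1 < g) :
    1 - ((f * g - C) / (√(f ^ 2 - 1) * √(g ^ 2 - 1))) ^ 2 =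
      hypGram C f g / (√(f ^ 2 - 1) * √(g ^ 2 - 1)) ^ 2 := by
  have hs := sqrt_sq_sub_one_pos hf
  have ht := sqrt_sq_sub_one_pos hg
  rw [div_pow, eq_div_iff (by positivity), sub_mul, div_mul_cancel₀ _ (by positivity), mul_pow,
    sq_sqrt_sq_sub_one hf, sq_sqrt_sq_sub_one hg, hypGram]
  ring

lemma sqrt_one_sub_cos_sq {C f g : ℝ} (hf : 1 < f) (hg : 1 < g) :
    √(1 - ((f * g - C) / (√(f ^ 2 - 1) * √(g ^ 2 - 1))) ^ 2) =
      √(hypGram C f g) / (√(f ^ 2 - 1) * √(g ^ 2 - 1)) := by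
  rw [one_sub_cos_sq hf hg, Real.sqrt_div' _ (by positivity), Real.sqrt_sq (by positivity)]

lemma hasDerivAt_hypAngle {C : ℝ} {f g : ℝ → ℝ} {f' g' t : ℝ} (hf : HasDerivAt f f' t)
    (hg : HasDerivAt g g' t) (hf1 : 1 < f t) (hg1 : 1 < g t) (hD : 0 < hypGram C (f t) (g t)) :
    HasDerivAt (fun s => hypAngle C (f s) (g s))
      (-(f' * ((C * f t - g t) / √(hypGram C (f t) (g t))) / (f t ^ 2 - 1) +
        g' * ((C * g t - f t) / √(hypGram C (f t) (g t))) / (g t ^ 2 - 1))) t := by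
  have hs := sqrt_sq_sub_one_pos hf1
  have ht := sqrt_sq_sub_one_pos hg1
  have hs2 := sq_sqrt_sq_sub_one hf1
  have ht2 := sq_sqrt_sq_sub_one hg1
  have hq := sqrt_one_sub_cos_sq (C := C) hf1 hg1
  have hu := one_sub_cos_sq (C := C) hf1 hg1
  have hupos : 0 < 1 - ((f t * g t - C) / (√(f t ^ 2 - 1) * √(g t ^ 2 - 1))) ^ 2 := by
    rw [hu]; positivity
  have hdS : HasDerivAt (fun s => √(f s ^ 2 - 1)) (f t * f' / √(f t ^ 2 - 1)) t := by
    refine (((hf.fun_pow 2).sub_const 1).sqrt (by nlinarith)).congr_deriv ?_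
    push_cast
    field_simp
  have hdT : HasDerivAt (fun s => √(g s ^ 2 - 1)) (g t * g' / √(g t ^ 2 - 1)) t := by
    refine (((hg.fun_pow 2).sub_const 1).sqrt (by nlinarith)).congr_deriv ?_
    push_cast
    field_simp
  have hdu := ((hf.fun_mul hg).sub_const C).fun_div (hdS.fun_mul hdT) (mul_pos hs ht).ne'
  have hda := (Real.hasDerivAt_arccos (x := (f t * g t - C) / (√(f t ^ 2 - 1) * √(g t ^ 2 - 1)))
    (by intro h; rw [h] at hupos; norm_num at hupos)
    (by intro h; rw [h] at hupos; norm_num at hupos)).comp t hdu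
  refine hda.congr_deriv ?_
  have hD' := Real.sqrt_pos.2 hD
  rw [hq]
  clear hdu hda hupos hu hq hdS hdT
  generalize √(hypGram C (f t) (g t)) = d at *
  generalize √(f t ^ 2 - 1) = S at *
  generalize √(g t ^ 2 - 1) = T at *
  rw [← hs2, ← ht2]
  field_simp
  rw [hs2, ht2]
  ring

/-- For two right triangles with the same hypotenuse, the sum of the cotangents has the sign of the
sum of the cosines. -/
lemma exists_pos_div_add_div {p q p' q' : ℝ} (hq : 0 < q) (hq' : 0 < q')
    (h : p ^ 2 + q ^ 2 = p' ^ 2 + q' ^ 2) :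
    ∃ k : ℝ, 0 < k ∧ p / q + p' / q' = k * (p + p') := by
  refine ⟨((q + q') ^ 2 + (p - p') ^ 2) / (2 * (q + q') * (q * q')), by positivity, ?_⟩
  field_simp
  linear_combination (p' - p) * h

/-- `exists_pos_div_add_div` for two hyperbolic triangles sharing the side `f`. -/
lemma exists_pos_slope_sum {C C' f g g' : ℝ} (hC : 1 < C) (hC' : 1 < C')
    (hD : 0 < hypGram C f g) (hD' : 0 < hypGram C' f g') :
    ∃ k : ℝ, 0 < k ∧ (C * f - g) / √(hypGram C f g) + (C' * f - g') / √(hypGram C' f g') =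
      k * (hypSlope C f g + hypSlope C' f g') := by
  have hs := sqrt_sq_sub_one_pos hC
  have hs' := sqrt_sq_sub_one_pos hC'
  have h1 := Real.sqrt_pos.2 hD
  have h2 := Real.sqrt_pos.2 hD'
  have e := hypSlope_sq_add (f := f) (g := g) hC
  have e' := hypSlope_sq_add (f := f) (g := g') hC'
  obtain ⟨k, hk, h⟩ := exists_pos_div_add_div (p := hypSlope C f g) (p' := hypSlope C' f g')
    (div_pos h1 hs) (div_pos h2 hs') (by
      rw [div_pow, div_pow, Real.sq_sqrt hD.le, Real.sq_sqrt hD'.le, sq_sqrt_sq_sub_one hC,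
        sq_sqrt_sq_sub_one hC', e, e'])
  refine ⟨k, hk, ?_⟩
  rw [← h]
  unfold hypSlope
  rw [div_div_div_cancel_right₀ hs.ne', div_div_div_cancel_right₀ hs'.ne']

lemma continuousOn_hypAngle {C : ℝ} {f g : ℝ → ℝ} {s : Set ℝ} (hf : Continuous f)
    (hg : Continuous g) (hf1 : ∀ t ∈ s, 1 < f t) (hg1 : ∀ t ∈ s, 1 < g t) :
    ContinuousOn (fun t => hypAngle C (f t) (g t)) s := by
  unfold hypAngle
  refine Real.continuous_arccos.comp_continuousOn (ContinuousOn.div ?_ ?_ ?_)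
  · fun_prop
  · fun_prop
  · intro t ht
    exact ne_of_gt (mul_pos (sqrt_sq_sub_one_pos (hf1 t ht)) (sqrt_sq_sub_one_pos (hg1 t ht)))

/-- Along a segment of side pairs satisfying the triangle inequalities, the formula for the
derivative of the angle remains valid for stationary degenerate triangles. -/
lemma hasDerivAt_hypAngle_segment {C f g f' g' t : ℝ} (hC : 1 < C) (hf : 1 < f) (hf' : 1 < f')
    (hg : 1 < g) (hg' : 1 < g') (h : 0 ≤ hypGram C f g) (h' : 0 ≤ hypGram C f' g')
    (ht0 : 0 < t) (ht1 : t < 1) {x y D : ℝ} (hx : x = f + t * (f' - f))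
    (hy : y = g + t * (g' - g)) (hD : D = √(hypGram C x y)) :
    HasDerivAt (fun s => hypAngle C (f + s * (f' - f)) (g + s * (g' - g)))
      (-((f' - f) * ((C * x - y) / D) / (x ^ 2 - 1) +
        (g' - g) * ((C * y - x) / D) / (y ^ 2 - 1))) t := by
  subst hx hy hD
  by_cases hne : f ≠ f' ∨ g ≠ g'
  · have hd : ∀ a b : ℝ, HasDerivAt (fun s => a + s * b) b t := fun a b => by
      simpa using ((hasDerivAt_id t).mul_const b).const_add a
    exact hasDerivAt_hypAngle (hd f (f' - f)) (hd g (g' - g)) (by nlinarith) (by nlinarith)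
      (hypGram_pos_of_between hC hf hf' h h' hne ht0 ht1)
  · push Not at hne
    obtain ⟨rfl, rfl⟩ := hne
    simpa using hasDerivAt_const t _

/-- Two convex hyperbolic cone polygons with the same side lengths coincide if the vertices of one
are at least as far from the cone point as those of the other and its cone angle is at least as
large. -/
theorem hypStar_rigid {n : ℕ} [NeZero n] {C f g : Fin n → ℝ} (hC : ∀ i, 1 < C i)
    (hf : ∀ i, 1 < f i) (hg : ∀ i, 1 < g i)
    (hDf : ∀ i, 0 ≤ hypGram (C i) (f i) (f (i + 1)))
    (hDg : ∀ i, 0 ≤ hypGram (C i) (g i) (g (i + 1)))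
    (hPf : ∀ i, 0 ≤ hypSlope (C (i - 1)) (f i) (f (i - 1)) + hypSlope (C i) (f i) (f (i + 1)))
    (hPg : ∀ i, 0 ≤ hypSlope (C (i - 1)) (g i) (g (i - 1)) + hypSlope (C i) (g i) (g (i + 1)))
    (hle : ∀ i, f i ≤ g i)
    (hang : ∑ i, hypAngle (C i) (f i) (f (i + 1)) ≤ ∑ i, hypAngle (C i) (g i) (g (i + 1))) :
    f = g := by
  by_contra hne
  obtain ⟨j, hj⟩ := Function.ne_iff.1 hne
  obtain ⟨m, -, hm⟩ := Finset.exists_max_image Finset.univ (fun i => g i - f i) ⟨j, by simp⟩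
  have hmpos : 0 < g m - f m :=
    (sub_pos.2 (lt_of_le_of_ne (hle j) hj)).trans_le (hm j (by simp))
  set F : ℝ → Fin n → ℝ := fun t i => f i + t * (g i - f i) with hF
  have hF1 : ∀ t ∈ Set.Icc (0 : ℝ) 1, ∀ i, 1 < F t i := fun t ht i => by
    have := mul_nonneg ht.1 (sub_nonneg.2 (hle i))
    have := hf i
    simp only [hF]
    linarith
  have hslope : ∀ (c : ℝ) (t : ℝ) (i k : Fin n), hypSlope c (F t i) (F t k) =
      (1 - t) * hypSlope c (f i) (f k) + t * hypSlope c (g i) (g k) := fun c t i k => by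
    simp only [hypSlope, hF]; ring
  have hstep : ∀ c, 1 < c → ∀ k, hypSlope c (f m) (f k) < hypSlope c (g m) (g k) :=
    fun c hc k => by
      have := hm k (by simp)
      refine div_lt_div_of_pos_right ?_ (sqrt_sq_sub_one_pos hc)
      nlinarith
  have hanti : StrictAntiOn (fun t => ∑ i, hypAngle (C i) (F t i) (F t (i + 1)))
      (Set.Icc (0 : ℝ) 1) := by
    refine strictAntiOn_of_deriv_neg (convex_Icc 0 1) ?_ ?_
    · refine continuousOn_finsetSum _ fun i _ => ?_
      exact continuousOn_hypAngle (by fun_prop) (by fun_prop) (fun t ht => hF1 t ht i)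
        (fun t ht => hF1 t ht (i + 1))
    · intro t ht
      rw [interior_Icc] at ht
      have hd := HasDerivAt.fun_sum (u := Finset.univ) fun i _ =>
        hasDerivAt_hypAngle_segment (hC i) (hf i) (hg i) (hf (i + 1)) (hg (i + 1)) (hDf i) (hDg i)
          ht.1 ht.2 (x := F t i) (y := F t (i + 1)) rfl rfl rfl
      rw [hd.deriv, Finset.sum_neg_distrib, neg_lt_zero, Finset.sum_add_distrib]
      rw [← (Equiv.subRight (1 : Fin n)).sum_comp (fun i => (g (i + 1) - f (i + 1)) * _ / _),
        ← Finset.sum_add_distrib]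
      simp only [Equiv.subRight_apply, sub_add_cancel]
      have hpos : ∀ i, 0 < g i - f i → ∃ k : ℝ, 0 < k ∧
          (g i - f i) * ((C i * F t i - F t (i + 1)) / √(hypGram (C i) (F t i) (F t (i + 1)))) /
              (F t i ^ 2 - 1) +
            (g i - f i) * ((C (i - 1) * F t i - F t (i - 1)) /
              √(hypGram (C (i - 1)) (F t (i - 1)) (F t i))) / (F t i ^ 2 - 1) =
          k * (hypSlope (C (i - 1)) (F t i) (F t (i - 1)) +
            hypSlope (C i) (F t i) (F t (i + 1))) := by
        intro i hi
        have hFi := hF1 t ⟨ht.1.le, ht.2.le⟩ i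
        have hD1 : 0 < hypGram (C i) (F t i) (F t (i + 1)) :=
          hypGram_pos_of_between (hC i) (hf i) (hg i) (hDf i) (hDg i)
            (Or.inl (sub_pos.1 hi).ne) ht.1 ht.2
        have hD0 : 0 < hypGram (C (i - 1)) (F t i) (F t (i - 1)) := by
          have h1 := hDf (i - 1)
          have h2 := hDg (i - 1)
          rw [sub_add_cancel, hypGram_comm] at h1 h2
          exact hypGram_pos_of_between (hC (i - 1)) (hf i) (hg i) h1 h2
            (Or.inl (sub_pos.1 hi).ne) ht.1 ht.2
        obtain ⟨k, hk, h⟩ := exists_pos_slope_sum (hC (i - 1)) (hC i) hD0 hD1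
        have hpos : 0 < F t i ^ 2 - 1 := by nlinarith
        refine ⟨(g i - f i) / (F t i ^ 2 - 1) * k, by positivity, ?_⟩
        rw [mul_assoc, ← h, hypGram_comm (C (i - 1)) (F t (i - 1))]
        ring
      have hsum : ∀ i, 0 ≤ hypSlope (C (i - 1)) (F t i) (F t (i - 1)) +
          hypSlope (C i) (F t i) (F t (i + 1)) := fun i => by
        rw [hslope, hslope]
        have h1 := mul_nonneg (sub_nonneg.2 ht.2.le) (hPf i)
        have h2 := mul_nonneg ht.1.le (hPg i)
        linarith
      refine Finset.sum_pos' (fun i _ => ?_) ⟨m, by simp, ?_⟩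
      · rcases (sub_nonneg.2 (hle i)).eq_or_lt with h0 | h0
        · simp [← h0]
        · obtain ⟨k, hk, h⟩ := hpos i h0
          rw [h]
          exact mul_nonneg hk.le (hsum i)
      · obtain ⟨k, hk, h⟩ := hpos m hmpos
        rw [h]
        refine mul_pos hk ?_
        rw [hslope, hslope]
        have h1 := mul_nonneg (sub_nonneg.2 ht.2.le) (hPf m)
        have h2 := hstep _ (hC (m - 1)) (m - 1)
        have h3 := hstep _ (hC m) (m + 1)
        have h4 : 0 < t * (hypSlope (C (m - 1)) (g m) (g (m - 1)) +
            hypSlope (C m) (g m) (g (m + 1))) := mul_pos ht.1 (by linarith [hPf m])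
        linarith
  have := hanti (by simp) (by simp) zero_lt_one
  simp only [hF, zero_mul, add_zero, one_mul, add_sub_cancel] at this
  exact this.not_ge hang

lemma lenr_sq {I a b : ℝ} (hI : 1 < I) (ha : 0 < a) (hb : 0 < b) :
    lenr I a b ^ 2 = a ^ 2 + b ^ 2 + 2 * a * b * I :=
  Real.sq_sqrt (by positivity)

lemma lenr_comm (I a b : ℝ) : lenr I a b = lenr I b a := by
  unfold lenr; congr 1; ring

lemma lenr_pos {I a b : ℝ} (hI : 1 < I) (ha : 0 < a) (hb : 0 < b) : 0 < lenr I a b :=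
  Real.sqrt_pos.2 (by positivity)

lemma spokeCosh_mul {I x : ℝ} (hI : 1 < I) : spokeCosh I x * √(I ^ 2 - 1) = x + I :=
  div_mul_cancel₀ _ (sqrt_sq_sub_one_pos hI).ne'

lemma edgeCosh_mul {I J K : ℝ} (hI : 1 < I) (hJ : 1 < J) :
    edgeCosh I J K * (√(I ^ 2 - 1) * √(J ^ 2 - 1)) = K + I * J :=
  div_mul_cancel₀ _ (mul_pos (sqrt_sq_sub_one_pos hI) (sqrt_sq_sub_one_pos hJ)).ne'

lemma lenr_eq_mul {I a b : ℝ} (hI : 1 < I) (ha : 0 < a) (hb : 0 < b) :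
    lenr I a b = b * √(I ^ 2 - 1) * √(spokeCosh I (a / b) ^ 2 - 1) := by
  have hf := one_lt_spokeCosh hI (div_pos ha hb)
  have hs := sqrt_sq_sub_one_pos hI
  have hS := sqrt_sq_sub_one_pos hf
  refine (sq_eq_sq₀ (lenr_pos hI ha hb).le (by positivity)).1 ?_
  have h1 := spokeCosh_mul (x := a / b) hI
  have h2 := sq_sqrt_sq_sub_one hI
  rw [lenr_sq hI ha hb, mul_pow, mul_pow, sq_sqrt_sq_sub_one hf]
  calc _ = b ^ 2 * ((a / b + I) ^ 2 - (I ^ 2 - 1)) := by field_simp; ring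
    _ = _ := by rw [← h1]; linear_combination b ^ 2 * h2

lemma cosine_numerator {I J K a b c : ℝ} (hI : 1 < I) (hJ : 1 < J) (hK : 1 < K)
    (ha : 0 < a) (hb : 0 < b) (hc : 0 < c) :
    lenr I a b ^ 2 + lenr J a c ^ 2 - lenr K b c ^ 2 =
      2 * b * c * (√(I ^ 2 - 1) * √(J ^ 2 - 1)) *
        (spokeCosh I (a / b) * spokeCosh J (a / c) - edgeCosh I J K) := by
  have h1 := spokeCosh_mul (x := a / b) hI
  have h2 := spokeCosh_mul (x := a / c) hJ
  have h3 := edgeCosh_mul (K := K) hI hJ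
  rw [lenr_sq hI ha hb, lenr_sq hJ ha hc, lenr_sq hK hb hc]
  calc _ = 2 * b * c * ((a / b + I) * (a / c + J) - (K + I * J)) := by field_simp; ring
    _ = _ := by rw [← h1, ← h2, ← h3]; ring

lemma cosine_eq {I J K a b c : ℝ} (hI : 1 < I) (hJ : 1 < J) (hK : 1 < K)
    (ha : 0 < a) (hb : 0 < b) (hc : 0 < c) :
    (lenr I a b ^ 2 + lenr J a c ^ 2 - lenr K b c ^ 2) / (2 * lenr I a b * lenr J a c) =
      (spokeCosh I (a / b) * spokeCosh J (a / c) - edgeCosh I J K) /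
        (√(spokeCosh I (a / b) ^ 2 - 1) * √(spokeCosh J (a / c) ^ 2 - 1)) := by
  have hs := sqrt_sq_sub_one_pos hI
  have ht := sqrt_sq_sub_one_pos hJ
  have hS := sqrt_sq_sub_one_pos (one_lt_spokeCosh hI (div_pos ha hb))
  have hT := sqrt_sq_sub_one_pos (one_lt_spokeCosh hJ (div_pos ha hc))
  rw [cosine_numerator hI hJ hK ha hb hc, lenr_eq_mul hI ha hb, lenr_eq_mul hJ ha hc]
  generalize √(spokeCosh I (a / b) ^ 2 - 1) = S at *
  generalize √(spokeCosh J (a / c) ^ 2 - 1) = T at *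
  field_simp

lemma ang0_eq_hypAngle {I J K a b c : ℝ} (hI : 1 < I) (hJ : 1 < J) (hK : 1 < K)
    (ha : 0 < a) (hb : 0 < b) (hc : 0 < c) :
    ang0 (lenr I a b) (lenr J a c) (lenr K b c) =
      hypAngle (edgeCosh I J K) (spokeCosh I (a / b)) (spokeCosh J (a / c)) := by
  rw [ang0, hypAngle, cosine_eq hI hJ hK ha hb hc]

/-- Heron's formula: the squared area of the Euclidean triangle is a multiple of the Gram
determinant of the hyperbolic one. -/
lemma heron_eq {I J K a b c : ℝ} (hI : 1 < I) (hJ : 1 < J) (hK : 1 < K)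
    (ha : 0 < a) (hb : 0 < b) (hc : 0 < c) :
    ((lenr I a b + lenr J a c + lenr K b c) * (lenr I a b + lenr J a c - lenr K b c)) *
      ((lenr J a c + lenr K b c - lenr I a b) * (lenr I a b + lenr K b c - lenr J a c)) =
      (2 * b * c * (√(I ^ 2 - 1) * √(J ^ 2 - 1))) ^ 2 *
        hypGram (edgeCosh I J K) (spokeCosh I (a / b)) (spokeCosh J (a / c)) := by
  have h := cosine_numerator hI hJ hK ha hb hc
  have hx := lenr_eq_mul hI ha hb
  have hy := lenr_eq_mul hJ ha hc
  have hS := sq_sqrt_sq_sub_one (one_lt_spokeCosh hI (div_pos ha hb))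
  have hT := sq_sqrt_sq_sub_one (one_lt_spokeCosh hJ (div_pos ha hc))
  calc _ = (2 * lenr I a b * lenr J a c) ^ 2 -
        (lenr I a b ^ 2 + lenr J a c ^ 2 - lenr K b c ^ 2) ^ 2 := by ring
    _ = (2 * b * c * (√(I ^ 2 - 1) * √(J ^ 2 - 1))) ^ 2 *
        (√(spokeCosh I (a / b) ^ 2 - 1) ^ 2 * √(spokeCosh J (a / c) ^ 2 - 1) ^ 2 -
        (spokeCosh I (a / b) * spokeCosh J (a / c) - edgeCosh I J K) ^ 2) := by
      rw [h, hx, hy]; ring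
    _ = _ := by rw [hS, hT, hypGram]; ring

lemma hypGram_nonneg_of_triangle {I J K a b c : ℝ} (hI : 1 < I) (hJ : 1 < J) (hK : 1 < K)
    (ha : 0 < a) (hb : 0 < b) (hc : 0 < c) (h1 : lenr I a b ≤ lenr J a c + lenr K b c)
    (h2 : lenr J a c ≤ lenr I a b + lenr K b c) (h3 : lenr K b c ≤ lenr I a b + lenr J a c) :
    0 ≤ hypGram (edgeCosh I J K) (spokeCosh I (a / b)) (spokeCosh J (a / c)) := by
  have hs := sqrt_sq_sub_one_pos hI
  have ht := sqrt_sq_sub_one_pos hJ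
  have hx := lenr_pos hI ha hb
  have hy := lenr_pos hJ ha hc
  have hz := lenr_pos hK hb hc
  refine nonneg_of_mul_nonneg_right (a := (2 * b * c * (√(I ^ 2 - 1) * √(J ^ 2 - 1))) ^ 2) ?_
    (by positivity)
  rw [← heron_eq hI hJ hK ha hb hc]
  exact mul_nonneg (mul_nonneg (by linarith) (by linarith))
    (mul_nonneg (by linarith) (by linarith))

lemma hypGram_pos_of_triangle {I J K a b c : ℝ} (hI : 1 < I) (hJ : 1 < J) (hK : 1 < K)
    (ha : 0 < a) (hb : 0 < b) (hc : 0 < c) (h1 : lenr I a b < lenr J a c + lenr K b c)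
    (h2 : lenr J a c < lenr I a b + lenr K b c) (h3 : lenr K b c < lenr I a b + lenr J a c) :
    0 < hypGram (edgeCosh I J K) (spokeCosh I (a / b)) (spokeCosh J (a / c)) := by
  have hx := lenr_pos hI ha hb
  have hy := lenr_pos hJ ha hc
  have hz := lenr_pos hK hb hc
  refine pos_of_mul_pos_right (a := (2 * b * c * (√(I ^ 2 - 1) * √(J ^ 2 - 1))) ^ 2) ?_
    (by positivity)
  rw [← heron_eq hI hJ hK ha hb hc]
  exact mul_pos (mul_pos (by linarith) (by linarith)) (mul_pos (by linarith) (by linarith))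

lemma edge_center_eq {I a b : ℝ} (hI : 1 < I) (ha : 0 < a) (hb : 0 < b) :
    (a ^ 2 + a * b * I) / lenr I a b =
      a * spokeCosh I (a / b) / √(spokeCosh I (a / b) ^ 2 - 1) := by
  have hs := sqrt_sq_sub_one_pos hI
  have hS := sqrt_sq_sub_one_pos (one_lt_spokeCosh hI (div_pos ha hb))
  have h1 := spokeCosh_mul (x := a / b) hI
  rw [lenr_eq_mul hI ha hb, div_eq_div_iff (by positivity) hS.ne']
  calc _ = a * b * (a / b + I) * √(spokeCosh I (a / b) ^ 2 - 1) := by field_simp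
    _ = _ := by rw [← h1]; ring

/-- The slope at the spoke `I`, expressed through the edge centers. -/
lemma edge_center_sub {I J K a b c : ℝ} (hI : 1 < I) (hJ : 1 < J) (hK : 1 < K)
    (ha : 0 < a) (hb : 0 < b) (hc : 0 < c) :
    (a ^ 2 + a * c * J) / lenr J a c - (a ^ 2 + a * b * I) / lenr I a b *
      ((lenr I a b ^ 2 + lenr J a c ^ 2 - lenr K b c ^ 2) / (2 * lenr I a b * lenr J a c)) =
      a / (√(spokeCosh I (a / b) ^ 2 - 1) ^ 2 * √(spokeCosh J (a / c) ^ 2 - 1)) *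
        (edgeCosh I J K * spokeCosh I (a / b) - spokeCosh J (a / c)) := by
  have hS := sqrt_sq_sub_one_pos (one_lt_spokeCosh hI (div_pos ha hb))
  have hT := sqrt_sq_sub_one_pos (one_lt_spokeCosh hJ (div_pos ha hc))
  have hS2 := sq_sqrt_sq_sub_one (one_lt_spokeCosh hI (div_pos ha hb))
  rw [cosine_eq hI hJ hK ha hb hc, edge_center_eq hI ha hb, edge_center_eq hJ ha hc]
  generalize √(spokeCosh I (a / b) ^ 2 - 1) = S at *
  generalize √(spokeCosh J (a / c) ^ 2 - 1) = T at *
  field_simp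
  rw [hS2]
  ring

/-- In a triangle degenerating at the center or at the outer end of the spoke `I`, the slope at this
spoke is nonnegative. -/
lemma slope_nonneg_of_flat {I J K a b c : ℝ} (hI : 1 < I) (hJ : 1 < J) (hK : 1 < K)
    (ha : 0 < a) (hb : 0 < b) (hc : 0 < c)
    (h : lenr J a c = lenr I a b + lenr K b c ∨ lenr K b c = lenr I a b + lenr J a c) :
    0 ≤ edgeCosh I J K * spokeCosh I (a / b) - spokeCosh J (a / c) := by
  have hx := lenr_pos hI ha hb
  have hy := lenr_pos hJ ha hc
  have hz := lenr_pos hK hb hc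
  have hS := sqrt_sq_sub_one_pos (one_lt_spokeCosh hI (div_pos ha hb))
  have hT := sqrt_sq_sub_one_pos (one_lt_spokeCosh hJ (div_pos ha hc))
  have hx2 := lenr_sq hI ha hb
  have hy2 := lenr_sq hJ ha hc
  have hz2 := lenr_sq hK hb hc
  refine nonneg_of_mul_nonneg_right (a := a / (√(spokeCosh I (a / b) ^ 2 - 1) ^ 2 *
    √(spokeCosh J (a / c) ^ 2 - 1))) ?_ (by positivity)
  rw [← edge_center_sub hI hJ hK ha hb hc]
  rcases h with h | h
  · have hcos : (lenr I a b ^ 2 + lenr J a c ^ 2 - lenr K b c ^ 2) /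
        (2 * lenr I a b * lenr J a c) = 1 := by
      rw [div_eq_one_iff_eq (by positivity), h]; ring
    rw [hcos, mul_one, sub_nonneg, div_le_div_iff₀ hx hy]
    have e1 : 2 * (a ^ 2 + a * b * I) = lenr I a b ^ 2 + a ^ 2 - b ^ 2 := by rw [hx2]; ring
    have e2 : 2 * (a ^ 2 + a * c * J) = lenr J a c ^ 2 + a ^ 2 - c ^ 2 := by rw [hy2]; ring
    have b1 : a ^ 2 ≤ lenr I a b ^ 2 := by
      rw [hx2, add_assoc]
      exact le_add_of_nonneg_right (by positivity)
    have b2 : c ^ 2 ≤ lenr K b c ^ 2 := by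
      rw [hz2, add_comm (b ^ 2), add_assoc]
      exact le_add_of_nonneg_right (by positivity)
    clear hx2 hy2 hz2 hcos
    generalize lenr I a b = x at *
    generalize lenr K b c = z at *
    generalize lenr J a c = y at *
    subst h
    have k1 := mul_nonneg hz.le (sub_nonneg.2 b1)
    have k2 := mul_nonneg hx.le (sub_nonneg.2 b2)
    have k3 : 0 ≤ (x + z) * b ^ 2 := by positivity
    nlinarith
  · have hcos : (lenr I a b ^ 2 + lenr J a c ^ 2 - lenr K b c ^ 2) /
        (2 * lenr I a b * lenr J a c) = -1 := by
      rw [div_eq_iff (by positivity), h]; ring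
    rw [hcos]
    have : 0 ≤ (a ^ 2 + a * c * J) / lenr J a c := by positivity
    have : 0 ≤ (a ^ 2 + a * b * I) / lenr I a b := by positivity
    linarith

lemma abs_hypSlope_le {C f g : ℝ} (hC : 1 < C) (h : 0 ≤ hypGram C f g) :
    |hypSlope C f g| ≤ √(f ^ 2 - 1) := by
  have := hypSlope_sq_add (f := f) (g := g) hC
  have := div_nonneg h (by nlinarith : 0 ≤ C ^ 2 - 1)
  exact Real.abs_le_sqrt (by linarith)

/-- The extended angle `thetaEdge` in hyperbolic terms. -/
lemma thetaEdge_cases {I J K a b c : ℝ} (hI : 1 < I) (hJ : 1 < J) (hK : 1 < K)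
    (ha : 0 < a) (hb : 0 < b) (hc : 0 < c) (h1 : lenr I a b ≤ lenr J a c + lenr K b c)
    (h2 : lenr J a c ≤ lenr I a b + lenr K b c) (h3 : lenr K b c ≤ lenr I a b + lenr J a c)
    {θ C f g : ℝ} (hC : C = edgeCosh I J K) (hf : f = spokeCosh I (a / b))
    (hg : g = spokeCosh J (a / c))
    (hθ : θ = thetaEdge (lenr I a b) (lenr J a c) (lenr K b c)
      ((a ^ 2 + a * b * I) / lenr I a b) ((a ^ 2 + a * c * J) / lenr J a c)) :
    (0 < hypGram C f g ∧ θ = Real.arctan ((C * f - g) / √(hypGram C f g) / f)) ∨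
      θ = -(Real.pi / 2) ∨ (θ = Real.pi / 2 ∧ hypSlope C f g = √(f ^ 2 - 1)) := by
  have hC1 : 1 < C := hC ▸ one_lt_edgeCosh hI hJ hK
  have hf1 : 1 < f := hf ▸ one_lt_spokeCosh hI (div_pos ha hb)
  have hg1 : 1 < g := hg ▸ one_lt_spokeCosh hJ (div_pos ha hc)
  unfold thetaEdge at hθ
  split_ifs at hθ with hlt hflat
  · left
    have hD := hypGram_pos_of_triangle hI hJ hK ha hb hc hlt.1 hlt.2.1 hlt.2.2
    have hcos := cosine_eq hI hJ hK ha hb hc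
    have hsub := edge_center_sub hI hJ hK ha hb hc
    have hcen := edge_center_eq hI ha hb
    rw [← hC, ← hf, ← hg] at hD
    rw [← hC, ← hf, ← hg] at hcos hsub
    rw [← hf] at hcen
    have hS := sqrt_sq_sub_one_pos hf1
    have hT := sqrt_sq_sub_one_pos hg1
    have hu := one_sub_cos_sq (C := C) hf1 hg1
    have hq := sqrt_one_sub_cos_sq (C := C) hf1 hg1
    have hle : ((f * g - C) / (√(f ^ 2 - 1) * √(g ^ 2 - 1))) ^ 2 ≤ 1 := by
      rw [← sub_nonneg, hu]; positivity
    have hle' := abs_le.1 ((sq_le_one_iff_abs_le_one _).1 hle)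
    refine ⟨hD, hθ.trans ?_⟩
    rw [ang0, Real.sin_arccos, Real.cos_arccos (hcos ▸ hle'.1) (hcos ▸ hle'.2), hsub, hcos, hq,
      hcen]
    have hD' := Real.sqrt_pos.2 hD
    generalize √(f ^ 2 - 1) = S at *
    generalize √(g ^ 2 - 1) = T at *
    generalize √(hypGram C f g) = d at *
    have : f ≠ 0 := by positivity
    congr 1
    field_simp
  · exact Or.inr (Or.inl hθ)
  · right; right
    refine ⟨hθ, ?_⟩
    have hflat' : lenr J a c = lenr I a b + lenr K b c ∨ lenr K b c = lenr I a b + lenr J a c := by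
      by_contra hcon
      push Not at hcon
      exact hlt ⟨lt_of_le_of_ne h1 hflat, lt_of_le_of_ne h2 hcon.1, lt_of_le_of_ne h3 hcon.2⟩
    have hD0 : hypGram C f g = 0 := by
      have hh := heron_eq hI hJ hK ha hb hc
      rw [← hC, ← hf, ← hg] at hh
      have hs := sqrt_sq_sub_one_pos hI
      have ht := sqrt_sq_sub_one_pos hJ
      have : (2 * b * c * (√(I ^ 2 - 1) * √(J ^ 2 - 1))) ^ 2 * hypGram C f g = 0 := by
        rw [← hh]
        rcases hflat' with h | h <;> rw [h] <;> ring
      exact (mul_eq_zero.1 this).resolve_left (by positivity)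
    have hn := slope_nonneg_of_flat hI hJ hK ha hb hc hflat'
    rw [← hC, ← hf, ← hg] at hn
    have e := hypSlope_sq_add (f := f) (g := g) hC1
    rw [hD0, zero_div, add_zero] at e
    rw [← e, Real.sqrt_sq]
    exact div_nonneg hn (Real.sqrt_nonneg _)

/-- The Delaunay condition at a spoke in hyperbolic terms. -/
lemma slope_sum_nonneg {C C' f g g' θ θ' : ℝ} (hC : 1 < C) (hC' : 1 < C') (hf : 1 < f)
    (hD : 0 ≤ hypGram C f g) (hD' : 0 ≤ hypGram C' f g')
    (h : (0 < hypGram C f g ∧ θ = Real.arctan ((C * f - g) / √(hypGram C f g) / f)) ∨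
      θ = -(Real.pi / 2) ∨ (θ = Real.pi / 2 ∧ hypSlope C f g = √(f ^ 2 - 1)))
    (h' : (0 < hypGram C' f g' ∧ θ' = Real.arctan ((C' * f - g') / √(hypGram C' f g') / f)) ∨
      θ' = -(Real.pi / 2) ∨ (θ' = Real.pi / 2 ∧ hypSlope C' f g' = √(f ^ 2 - 1)))
    (hsum : 0 ≤ θ + θ') : 0 ≤ hypSlope C f g + hypSlope C' f g' := by
  have b := abs_le.1 (abs_hypSlope_le hC hD)
  have b' := abs_le.1 (abs_hypSlope_le hC' hD')
  have hpi := Real.pi_pos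
  rcases h with ⟨hD, rfl⟩ | rfl | ⟨rfl, hp⟩ <;> rcases h' with ⟨hD', rfl⟩ | rfl | ⟨rfl, hp'⟩
  · obtain ⟨k, hk, e⟩ := exists_pos_slope_sum hC hC' hD hD'
    rw [← neg_le_iff_add_nonneg, ← Real.arctan_neg, Real.arctan_le_arctan_iff,
      neg_le_iff_add_nonneg, ← add_div, e, le_div_iff₀ (by linarith), zero_mul] at hsum
    exact nonneg_of_mul_nonneg_right hsum hk
  · linarith [Real.arctan_lt_pi_div_two ((C * f - g) / √(hypGram C f g) / f)]
  · linarith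
  · linarith [Real.arctan_lt_pi_div_two ((C' * f - g') / √(hypGram C' f g') / f)]
  all_goals linarith

lemma genPacking.hypGram_nonneg {n : ℕ} [NeZero n] {I0 Ib : Fin n → ℝ} {r0 : ℝ} {r : Fin n → ℝ}
    (hgen : genPacking I0 Ib r0 r) (hI0 : ∀ i, 1 < I0 i) (hIb : ∀ i, 1 < Ib i) (hr0 : 0 < r0)
    (hr : ∀ i, 0 < r i) (i : Fin n) :
    0 ≤ hypGram (edgeCosh (I0 i) (I0 (i + 1)) (Ib i)) (spokeCosh (I0 i) (r0 / r i))
      (spokeCosh (I0 (i + 1)) (r0 / r (i + 1))) :=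
  hypGram_nonneg_of_triangle (hI0 i) (hI0 (i + 1)) (hIb i) hr0 (hr i) (hr (i + 1))
    (hgen i).1 (hgen i).2.1 (hgen i).2.2

lemma isDelaunay.slope_nonneg {n : ℕ} [NeZero n] {I0 Ib : Fin n → ℝ} {r0 : ℝ} {r : Fin n → ℝ}
    (hdel : isDelaunay I0 Ib r0 r) (hgen : genPacking I0 Ib r0 r) (hI0 : ∀ i, 1 < I0 i)
    (hIb : ∀ i, 1 < Ib i) (hr0 : 0 < r0) (hr : ∀ i, 0 < r i) (i : Fin n) :
    0 ≤ hypSlope (edgeCosh (I0 (i - 1)) (I0 (i - 1 + 1)) (Ib (i - 1)))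
        (spokeCosh (I0 i) (r0 / r i)) (spokeCosh (I0 (i - 1)) (r0 / r (i - 1))) +
      hypSlope (edgeCosh (I0 i) (I0 (i + 1)) (Ib i))
        (spokeCosh (I0 i) (r0 / r i)) (spokeCosh (I0 (i + 1)) (r0 / r (i + 1))) := by
  have hD := hgen.hypGram_nonneg hI0 hIb hr0 hr (i - 1)
  have htri := hgen (i - 1)
  have hd := hdel i
  simp only [spoke, bd, dcen, sub_add_cancel] at hd htri
  rw [sub_add_cancel, hypGram_comm, edgeCosh_comm] at hD
  rw [lenr_comm (Ib (i - 1))] at hd htri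
  rw [sub_add_cancel, edgeCosh_comm]
  exact slope_sum_nonneg (one_lt_edgeCosh (hI0 i) (hI0 (i - 1)) (hIb (i - 1)))
    (one_lt_edgeCosh (hI0 i) (hI0 (i + 1)) (hIb i))
    (one_lt_spokeCosh (hI0 i) (div_pos hr0 (hr i))) hD (hgen.hypGram_nonneg hI0 hIb hr0 hr i)
    (thetaEdge_cases (hI0 i) (hI0 (i - 1)) (hIb (i - 1)) hr0 (hr i) (hr (i - 1))
      htri.2.1 htri.1 (by linarith [htri.2.2]) rfl rfl rfl rfl)
    (thetaEdge_cases (hI0 i) (hI0 (i + 1)) (hIb i) hr0 (hr i) (hr (i + 1))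
      (hgen i).1 (hgen i).2.1 (hgen i).2.2 rfl rfl rfl rfl) hd

lemma curv0_eq_hypAngle {n : ℕ} [NeZero n] {I0 Ib : Fin n → ℝ} {r0 : ℝ} {r : Fin n → ℝ}
    (hI0 : ∀ i, 1 < I0 i) (hIb : ∀ i, 1 < Ib i) (hr0 : 0 < r0) (hr : ∀ i, 0 < r i) :
    curv0 I0 Ib r0 r = 2 * Real.pi - ∑ i, hypAngle (edgeCosh (I0 i) (I0 (i + 1)) (Ib i))
      (spokeCosh (I0 i) (r0 / r i)) (spokeCosh (I0 (i + 1)) (r0 / r (i + 1))) := by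
  unfold curv0
  congr 1
  exact Finset.sum_congr rfl fun i _ =>
    ang0_eq_hypAngle (hI0 i) (hI0 (i + 1)) (hIb i) hr0 (hr i) (hr (i + 1))

/-- Theorem 3.1 (Maximum principle): if `r` and `r̄` are generalized weighted
Delaunay inversive distance circle packings on the star triangulation of an
`n`-gon with the same weights `> 1`, `K₀(r) ≤ K₀(r̄)`, and
`max_i rᵢ/r̄ᵢ ≤ r₀/r̄₀`, then `r = c·r̄` for some constant `c > 0`. -/
theorem stmt_14 {n : ℕ} [NeZero n] (hn : 3 ≤ n) (I0 Ib : Fin n → ℝ)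
    (hI0 : ∀ i, 1 < I0 i) (hIb : ∀ i, 1 < Ib i)
    (r0 : ℝ) (r : Fin n → ℝ) (rb0 : ℝ) (rb : Fin n → ℝ)
    (hr0 : 0 < r0) (hr : ∀ i, 0 < r i) (hrb0 : 0 < rb0) (hrb : ∀ i, 0 < rb i)
    (hgen : genPacking I0 Ib r0 r) (hgenb : genPacking I0 Ib rb0 rb)
    (hdel : isDelaunay I0 Ib r0 r) (hdelb : isDelaunay I0 Ib rb0 rb)
    (hK : curv0 I0 Ib r0 r ≤ curv0 I0 Ib rb0 rb)
    (hmax : ∀ i, r i / rb i ≤ r0 / rb0) :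
    ∃ c : ℝ, 0 < c ∧ r0 = c * rb0 ∧ ∀ i, r i = c * rb i := by
  have hle : ∀ i, rb0 / rb i ≤ r0 / r i := fun i => by
    have := (div_le_div_iff₀ (hrb i) hrb0).1 (hmax i)
    rw [div_le_div_iff₀ (hrb i) (hr i)]
    linarith
  rw [curv0_eq_hypAngle hI0 hIb hr0 hr, curv0_eq_hypAngle hI0 hIb hrb0 hrb,
    sub_le_sub_iff_left] at hK
  have heq := hypStar_rigid (C := fun i => edgeCosh (I0 i) (I0 (i + 1)) (Ib i))
    (f := fun i => spokeCosh (I0 i) (rb0 / rb i)) (g := fun i => spokeCosh (I0 i) (r0 / r i))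
    (fun i => one_lt_edgeCosh (hI0 i) (hI0 (i + 1)) (hIb i))
    (fun i => one_lt_spokeCosh (hI0 i) (div_pos hrb0 (hrb i)))
    (fun i => one_lt_spokeCosh (hI0 i) (div_pos hr0 (hr i)))
    (hgenb.hypGram_nonneg hI0 hIb hrb0 hrb) (hgen.hypGram_nonneg hI0 hIb hr0 hr)
    (hdelb.slope_nonneg hgenb hI0 hIb hrb0 hrb) (hdel.slope_nonneg hgen hI0 hIb hr0 hr)
    (fun i => div_le_div_of_nonneg_right (add_le_add_left (hle i) _) (Real.sqrt_nonneg _)) hK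
  refine ⟨r0 / rb0, div_pos hr0 hrb0, (div_mul_cancel₀ _ hrb0.ne').symm, fun i => ?_⟩
  have h := congrFun heq i
  simp only [spokeCosh, div_left_inj' (sqrt_sq_sub_one_pos (hI0 i)).ne', add_left_inj] at h
  rw [div_eq_div_iff (hrb i).ne' (hr i).ne'] at h
  field_simp
  linarith
end

section
/- Consider a triangle v₀v₁v₂ with weights I₀ (on edge v₁v₂), I₁ (on edge v₀v₂), I₂ (on edge v₀v₁), all greater than 1, and radii r₀ = 1, r₁, r₂ > 0 with κ_i = 1/r_i. If the induced inversive distance edge lengths satisfy the non-strict triangle inequalities (i.e. the triple is a generalized inversive distance circle packing, equivalently Q ≥ 0), then κ₂ ≥ (1/(I₂² − 1)) · [κ₁γ₀ + γ₁ − sqrt((I₀² + I₁² + I₂² + 2I₀I₁I₂ − 1)(κ₁² + 2I₂κ₁ + 1))], where γ₀ = I₀ + I₁I₂ and γ₁ = I₁ + I₀I₂. In particular, if κ₁ → +∞ with I₀, I₁, I₂ fixed, then κ₂ → +∞. -/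
/-- The triple with radii `r₀ = 1, r₁, r₂` and weights `I₀, I₁, I₂` (with `I_k`
opposite `v_k`) satisfies the non-strict triangle inequalities. -/
def genTri (I₀ I₁ I₂ r₁ r₂ : ℝ) : Prop :=
  Real.sqrt (1 + r₁ ^ 2 + 2 * r₁ * I₂) ≤
      Real.sqrt (1 + r₂ ^ 2 + 2 * r₂ * I₁) + Real.sqrt (r₁ ^ 2 + r₂ ^ 2 + 2 * r₁ * r₂ * I₀) ∧
  Real.sqrt (1 + r₂ ^ 2 + 2 * r₂ * I₁) ≤
      Real.sqrt (1 + r₁ ^ 2 + 2 * r₁ * I₂) + Real.sqrt (r₁ ^ 2 + r₂ ^ 2 + 2 * r₁ * r₂ * I₀) ∧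
  Real.sqrt (r₁ ^ 2 + r₂ ^ 2 + 2 * r₁ * r₂ * I₀) ≤
      Real.sqrt (1 + r₁ ^ 2 + 2 * r₁ * I₂) + Real.sqrt (1 + r₂ ^ 2 + 2 * r₂ * I₁)

/-- Heron's quantity is nonnegative for three reals satisfying the triangle inequalities. -/
theorem sq_add_sq_sub_sq_sq_le {a b c : ℝ} (ha : 0 ≤ a) (hb : 0 ≤ b) (hc : 0 ≤ c)
    (hab : a ≤ b + c) (hba : b ≤ a + c) (hcab : c ≤ a + b) :
    (a ^ 2 + b ^ 2 - c ^ 2) ^ 2 ≤ 4 * a ^ 2 * b ^ 2 := by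
  have hlow : (a - b) ^ 2 ≤ c ^ 2 := sq_le_sq' (by linarith) (by linarith)
  have hupp : c ^ 2 ≤ (a + b) ^ 2 := sq_le_sq' (by linarith) hcab
  have h : (a ^ 2 + b ^ 2 - c ^ 2) ^ 2 ≤ (2 * a * b) ^ 2 :=
    sq_le_sq' (by linarith) (by linarith)
  linarith

/-- The quadratic form `Q` at `(1, 1 / r₁, 1 / r₂)` is nonnegative for a generalized
inversive distance circle packing. -/
theorem genTri.quadratic_nonneg {I₀ I₁ I₂ r₁ r₂ : ℝ} (hI₀ : 1 < I₀) (hI₁ : 1 < I₁)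
    (hI₂ : 1 < I₂) (hr₁ : 0 < r₁) (hr₂ : 0 < r₂) (h : genTri I₀ I₁ I₂ r₁ r₂) :
    0 ≤ (1 - I₀ ^ 2) + (1 / r₁) ^ 2 * (1 - I₁ ^ 2) + (1 / r₂) ^ 2 * (1 - I₂ ^ 2)
      + 2 * (1 / r₁) * (I₂ + I₀ * I₁) + 2 * (1 / r₂) * (I₁ + I₀ * I₂)
      + 2 * (1 / r₁) * (1 / r₂) * (I₀ + I₁ * I₂) := by
  obtain ⟨h₁, h₂, h₃⟩ := h
  have key := sq_add_sq_sub_sq_sq_le (Real.sqrt_nonneg _) (Real.sqrt_nonneg _)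
    (Real.sqrt_nonneg _) h₁ h₂ h₃
  rw [Real.sq_sqrt (by positivity), Real.sq_sqrt (by positivity),
    Real.sq_sqrt (by positivity)] at key
  have heq : (1 - I₀ ^ 2) + (1 / r₁) ^ 2 * (1 - I₁ ^ 2) + (1 / r₂) ^ 2 * (1 - I₂ ^ 2)
      + 2 * (1 / r₁) * (I₂ + I₀ * I₁) + 2 * (1 / r₂) * (I₁ + I₀ * I₂)
      + 2 * (1 / r₁) * (1 / r₂) * (I₀ + I₁ * I₂)
      = (4 * (1 + r₁ ^ 2 + 2 * r₁ * I₂) * (1 + r₂ ^ 2 + 2 * r₂ * I₁)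
        - (1 + r₁ ^ 2 + 2 * r₁ * I₂ + (1 + r₂ ^ 2 + 2 * r₂ * I₁)
          - (r₁ ^ 2 + r₂ ^ 2 + 2 * r₁ * r₂ * I₀)) ^ 2) / (4 * r₁ ^ 2 * r₂ ^ 2) := by
    field_simp
    ring
  rw [heq]
  exact div_nonneg (sub_nonneg.mpr key) (by positivity)

theorem genTri.lower_bound {I₀ I₁ I₂ r₁ r₂ : ℝ} (hI₀ : 1 < I₀) (hI₁ : 1 < I₁)
    (hI₂ : 1 < I₂) (hr₁ : 0 < r₁) (hr₂ : 0 < r₂) (h : genTri I₀ I₁ I₂ r₁ r₂) :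
    (1 / (I₂ ^ 2 - 1)) * ((1 / r₁) * (I₀ + I₁ * I₂) + (I₁ + I₀ * I₂) -
      Real.sqrt ((I₀ ^ 2 + I₁ ^ 2 + I₂ ^ 2 + 2 * I₀ * I₁ * I₂ - 1)
        * ((1 / r₁) ^ 2 + 2 * I₂ * (1 / r₁) + 1))) ≤ 1 / r₂ := by
  have hQ := h.quadratic_nonneg hI₀ hI₁ hI₂ hr₁ hr₂
  generalize 1 / r₁ = x at hQ ⊢
  generalize 1 / r₂ = y at hQ ⊢
  have hc : 0 < I₂ ^ 2 - 1 := by nlinarith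
  have hsqrt : x * (I₀ + I₁ * I₂) + (I₁ + I₀ * I₂) - (I₂ ^ 2 - 1) * y ≤
      Real.sqrt ((I₀ ^ 2 + I₁ ^ 2 + I₂ ^ 2 + 2 * I₀ * I₁ * I₂ - 1)
        * (x ^ 2 + 2 * I₂ * x + 1)) := by
    apply Real.le_sqrt_of_sq_le
    linear_combination (I₂ ^ 2 - 1) * hQ
  rw [one_div_mul_eq_div, div_le_iff₀ hc]
  linarith

/-- A lower bound for `1 / r₂` that is affine in `1 / r₁` with positive slope. -/
theorem genTri.affine_lower_bound {I₀ I₁ I₂ r₁ r₂ : ℝ} (hI₀ : 1 < I₀) (hI₁ : 1 < I₁)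
    (hI₂ : 1 < I₂) (hr₁ : 0 < r₁) (hr₂ : 0 < r₂) (h : genTri I₀ I₁ I₂ r₁ r₂) :
    (1 / (I₂ ^ 2 - 1)) *
      ((I₀ + I₁ * I₂ - Real.sqrt (I₀ ^ 2 + I₁ ^ 2 + I₂ ^ 2 + 2 * I₀ * I₁ * I₂ - 1)) * (1 / r₁)
        + (I₁ + I₀ * I₂
          - Real.sqrt (I₀ ^ 2 + I₁ ^ 2 + I₂ ^ 2 + 2 * I₀ * I₁ * I₂ - 1) * I₂)) ≤ 1 / r₂ := by
  refine le_trans ?_ (h.lower_bound hI₀ hI₁ hI₂ hr₁ hr₂)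
  have hx : 0 < 1 / r₁ := by positivity
  generalize 1 / r₁ = x at hx ⊢
  have hc : 0 < I₂ ^ 2 - 1 := by nlinarith
  have hD : 0 ≤ I₀ ^ 2 + I₁ ^ 2 + I₂ ^ 2 + 2 * I₀ * I₁ * I₂ - 1 := by
    have : 0 < 2 * I₀ * I₁ * I₂ := by positivity
    nlinarith
  have hsqrt : Real.sqrt (x ^ 2 + 2 * I₂ * x + 1) ≤ x + I₂ :=
    Real.sqrt_le_iff.mpr ⟨by linarith, by linarith⟩
  rw [Real.sqrt_mul hD]
  refine mul_le_mul_of_nonneg_left ?_ (by positivity)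
  have := mul_le_mul_of_nonneg_left hsqrt
    (Real.sqrt_nonneg (I₀ ^ 2 + I₁ ^ 2 + I₂ ^ 2 + 2 * I₀ * I₁ * I₂ - 1))
  linarith

theorem sqrt_discriminant_lt {I₀ I₁ I₂ : ℝ} (hI₀ : 1 < I₀) (hI₁ : 1 < I₁) (hI₂ : 1 < I₂) :
    Real.sqrt (I₀ ^ 2 + I₁ ^ 2 + I₂ ^ 2 + 2 * I₀ * I₁ * I₂ - 1) < I₀ + I₁ * I₂ := by
  rw [Real.sqrt_lt' (by positivity)]
  have : 0 < (I₁ ^ 2 - 1) * (I₂ ^ 2 - 1) := mul_pos (by nlinarith) (by nlinarith)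
  linarith

/-- Inequality (3.2): for a generalized inversive distance circle packing on the
triangle `v₀v₁v₂` with `r₀ = 1`,
`κ₂ ≥ (κ₁γ₀ + γ₁ − √((I₀² + I₁² + I₂² + 2I₀I₁I₂ − 1)(κ₁² + 2I₂κ₁ + 1)))/(I₂² − 1)`;
in particular `κ₁ → +∞` forces `κ₂ → +∞`. -/
theorem stmt_16 (I₀ I₁ I₂ : ℝ) (hI₀ : 1 < I₀) (hI₁ : 1 < I₁) (hI₂ : 1 < I₂) :
    (∀ r₁ r₂ : ℝ, 0 < r₁ → 0 < r₂ → genTri I₀ I₁ I₂ r₁ r₂ →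
      1 / r₂ ≥ (1 / (I₂ ^ 2 - 1)) *
        ((1 / r₁) * (I₀ + I₁ * I₂) + (I₁ + I₀ * I₂) -
          Real.sqrt ((I₀ ^ 2 + I₁ ^ 2 + I₂ ^ 2 + 2 * I₀ * I₁ * I₂ - 1)
            * ((1 / r₁) ^ 2 + 2 * I₂ * (1 / r₁) + 1)))) ∧
    (∀ s₁ s₂ : ℕ → ℝ, (∀ m, 0 < s₁ m) → (∀ m, 0 < s₂ m) →
      (∀ m, genTri I₀ I₁ I₂ (s₁ m) (s₂ m)) →
      Filter.Tendsto (fun m => 1 / s₁ m) Filter.atTop Filter.atTop →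
      Filter.Tendsto (fun m => 1 / s₂ m) Filter.atTop Filter.atTop) := by
  refine ⟨fun r₁ r₂ hr₁ hr₂ h => h.lower_bound hI₀ hI₁ hI₂ hr₁ hr₂,
    fun s₁ s₂ hs₁ hs₂ h hlim => ?_⟩
  have hc : 0 < 1 / (I₂ ^ 2 - 1) := one_div_pos.mpr (by nlinarith)
  have hslope := sub_pos.mpr (sqrt_discriminant_lt hI₀ hI₁ hI₂)
  exact Filter.tendsto_atTop_mono
    (fun m => (h m).affine_lower_bound hI₀ hI₁ hI₂ (hs₁ m) (hs₂ m))
    ((Filter.tendsto_atTop_add_const_right _ _ (hlim.const_mul_atTop hslope)).const_mul_atTop hc)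
end

section
/- Let v₁v₂v₃ be a triangle with constant weight I > 1 on all three edges and radii r₁, r₂, r₃ > 0 generating a non-degenerate triangle. There exists θ₀ = θ₀(I) ∈ (0, π/6), depending only on I, such that if all three inner angles of the triangle lie in the interval [π/6 − θ₀, π/2 + θ₀], then r_j ≤ 20 r_i for every pair of indices i, j ∈ {1, 2, 3}. -/
/-- A triangle side opposite an angle in `[π/8, π/2 + π/24]` is comparable with the other two. -/
lemma sides_comparable_of_angle_mem {a b c θ : ℝ} (ha : 0 < a) (hb : 0 < b)
    (hθ : θ = Real.arccos ((a ^ 2 + b ^ 2 - c ^ 2) / (2 * a * b)))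
    (hlow : Real.pi / 8 ≤ θ) (hupp : θ ≤ Real.pi / 2 + Real.pi / 24) :
    a ^ 2 ≤ 9 * c ^ 2 ∧ b ^ 2 ≤ 9 * c ^ 2 ∧ c ^ 2 ≤ 1.14 * (a ^ 2 + b ^ 2) := by
  have hpi := Real.pi_pos
  have hpi4 := Real.pi_lt_d2
  set q := (a ^ 2 + b ^ 2 - c ^ 2) / (2 * a * b) with hq
  have hab : 0 < 2 * a * b := by positivity
  have hqe : a ^ 2 + b ^ 2 - c ^ 2 = q * (2 * a * b) := by rw [hq]; field_simp
  have hq1 : q ≤ 1 := by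
    by_contra! h
    rw [Real.arccos_of_one_le h.le] at hθ
    linarith
  have hq2 : -1 ≤ q := by
    by_contra! h
    rw [Real.arccos_of_le_neg_one h.le] at hθ
    linarith
  have hcos : Real.cos θ = q := by rw [hθ, Real.cos_arccos hq2 hq1]
  have hqupp : q ≤ Real.cos (Real.pi / 8) :=
    hcos ▸ Real.cos_le_cos_of_nonneg_of_le_pi (by linarith) (by linarith) hlow
  have hqlow : -0.14 ≤ q := by
    have h1 : Real.cos (Real.pi / 2 + Real.pi / 24) ≤ q :=
      hcos ▸ Real.cos_le_cos_of_nonneg_of_le_pi (by linarith) (by linarith) hupp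
    rw [add_comm, Real.cos_add_pi_div_two] at h1
    have h2 : Real.sin (Real.pi / 24) < Real.pi / 24 := Real.sin_lt (by linarith)
    linarith
  have hcos8 : Real.cos (Real.pi / 8) ^ 2 ≤ 8 / 9 := by
    have h := Real.cos_sq (Real.pi / 8)
    rw [show 2 * (Real.pi / 8) = Real.pi / 4 by ring, Real.cos_pi_div_four] at h
    have h2 : √2 ≤ 1.5 := Real.sqrt_le_iff.2 (by norm_num)
    linarith
  set k := Real.cos (Real.pi / 8)
  have hqk : q * (2 * a * b) ≤ k * (2 * a * b) := mul_le_mul_of_nonneg_right hqupp hab.le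
  refine ⟨?_, ?_, ?_⟩
  · nlinarith [sq_nonneg (b - k * a), sq_nonneg a]
  · nlinarith [sq_nonneg (a - k * b), sq_nonneg b]
  · nlinarith [sq_nonneg (a - b), mul_le_mul_of_nonneg_right hqlow hab.le]

/-- If the two larger circles have radii `R ≥ s` and the side joining them is controlled by the
other sides, then the third radius is not small compared with `R`. -/
lemma le_twenty_mul_of_largest {I R s t : ℝ} (hI : 1 < I) (hR : 0 < R) (hs : 0 < s) (ht : 0 < t)
    (hsR : s ≤ R)
    (h₁ : R ^ 2 + s ^ 2 + 2 * I * R * s ≤ 9 * (s ^ 2 + t ^ 2 + 2 * I * s * t))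
    (h₂ : R ^ 2 + s ^ 2 + 2 * I * R * s ≤
      1.14 * ((R ^ 2 + t ^ 2 + 2 * I * R * t) + (s ^ 2 + t ^ 2 + 2 * I * s * t))) :
    R ≤ 20 * t := by
  by_contra! h
  have hRs : 0 < R * s := by positivity
  have hs5 : s < R / 5 := by
    by_contra! h5
    have e1 : t * (R + s) ≤ R / 20 * (R + s) := by gcongr; linarith
    have e2 : 0 ≤ R * s - 1.14 * (R / 20 * (R + s)) := by nlinarith
    have e3 : 0 ≤ (I - 1) * (R * s - 1.14 * (t * (R + s))) :=
      mul_nonneg (by linarith) (by nlinarith)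
    have e4 : t ^ 2 ≤ (R / 20) ^ 2 := by gcongr; linarith
    nlinarith
  have e1 : I * s * t ≤ I * s * (R / 20) := by gcongr; linarith
  have e2 : 0 < I * (R * s) := by positivity
  have e3 : t ^ 2 ≤ (R / 20) ^ 2 := by gcongr; linarith
  have e4 : s ^ 2 ≤ (R / 5) ^ 2 := by gcongr
  nlinarith

/-- If the side joining the circles of radii `R`, `s` is controlled by the other two sides, then
neither `R` nor `s` exceeds twenty times the third radius. -/
lemma le_twenty_mul_of_side_comparable {I R s t : ℝ} (hI : 1 < I) (hR : 0 < R) (hs : 0 < s)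
    (ht : 0 < t)
    (h₁ : R ^ 2 + s ^ 2 + 2 * I * R * s ≤ 9 * (s ^ 2 + t ^ 2 + 2 * I * s * t))
    (h₂ : R ^ 2 + s ^ 2 + 2 * I * R * s ≤ 9 * (R ^ 2 + t ^ 2 + 2 * I * R * t))
    (h₃ : R ^ 2 + s ^ 2 + 2 * I * R * s ≤
      1.14 * ((R ^ 2 + t ^ 2 + 2 * I * R * t) + (s ^ 2 + t ^ 2 + 2 * I * s * t))) :
    R ≤ 20 * t ∧ s ≤ 20 * t := by
  rcases le_total s R with h | h
  · have := le_twenty_mul_of_largest hI hR hs ht h h₁ h₃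
    exact ⟨this, h.trans this⟩
  · have := le_twenty_mul_of_largest hI hs hR ht h (by linarith) (by linarith)
    exact ⟨h.trans this, this⟩


/-- Lemma 5.5(a): for a non-degenerate inversive distance circle packing triangle
with constant weight `I > 1`, there exists `θ₀ = θ₀(I) ∈ (0, π/6)` such that if
all three inner angles lie in `[π/6 − θ₀, π/2 + θ₀]`, then any two radii have
ratio at most `20`. -/
theorem stmt_17 (I : ℝ) (hI : 1 < I) :
    ∃ θ₀ : ℝ, 0 < θ₀ ∧ θ₀ < Real.pi / 6 ∧
      ∀ r₁ r₂ r₃ l₁₂ l₁₃ l₂₃ θ₁ θ₂ θ₃ : ℝ,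
        0 < r₁ → 0 < r₂ → 0 < r₃ →
        l₁₂ = Real.sqrt (r₁ ^ 2 + r₂ ^ 2 + 2 * I * r₁ * r₂) →
        l₁₃ = Real.sqrt (r₁ ^ 2 + r₃ ^ 2 + 2 * I * r₁ * r₃) →
        l₂₃ = Real.sqrt (r₂ ^ 2 + r₃ ^ 2 + 2 * I * r₂ * r₃) →
        (l₁₂ < l₁₃ + l₂₃ ∧ l₁₃ < l₁₂ + l₂₃ ∧ l₂₃ < l₁₂ + l₁₃) →
        θ₁ = Real.arccos ((l₁₂ ^ 2 + l₁₃ ^ 2 - l₂₃ ^ 2) / (2 * l₁₂ * l₁₃)) →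
        θ₂ = Real.arccos ((l₁₂ ^ 2 + l₂₃ ^ 2 - l₁₃ ^ 2) / (2 * l₁₂ * l₂₃)) →
        θ₃ = Real.arccos ((l₁₃ ^ 2 + l₂₃ ^ 2 - l₁₂ ^ 2) / (2 * l₁₃ * l₂₃)) →
        (Real.pi / 6 - θ₀ ≤ θ₁ ∧ θ₁ ≤ Real.pi / 2 + θ₀) →
        (Real.pi / 6 - θ₀ ≤ θ₂ ∧ θ₂ ≤ Real.pi / 2 + θ₀) →
        (Real.pi / 6 - θ₀ ≤ θ₃ ∧ θ₃ ≤ Real.pi / 2 + θ₀) →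
        (r₁ ≤ 20 * r₂ ∧ r₂ ≤ 20 * r₁ ∧ r₁ ≤ 20 * r₃ ∧
         r₃ ≤ 20 * r₁ ∧ r₂ ≤ 20 * r₃ ∧ r₃ ≤ 20 * r₂) := by
  have hpi := Real.pi_pos
  refine ⟨Real.pi / 24, by linarith, by linarith, ?_⟩
  intro r₁ r₂ r₃ l₁₂ l₁₃ l₂₃ θ₁ θ₂ θ₃ hr₁ hr₂ hr₃ hl₁₂ hl₁₃ hl₂₃ _ hθ₁ hθ₂ hθ₃ hb₁ hb₂ hb₃
  have hp₁₂ : 0 < l₁₂ := hl₁₂ ▸ Real.sqrt_pos.2 (by positivity)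
  have hp₁₃ : 0 < l₁₃ := hl₁₃ ▸ Real.sqrt_pos.2 (by positivity)
  have hp₂₃ : 0 < l₂₃ := hl₂₃ ▸ Real.sqrt_pos.2 (by positivity)
  have hs₁₂ : l₁₂ ^ 2 = r₁ ^ 2 + r₂ ^ 2 + 2 * I * r₁ * r₂ :=
    hl₁₂ ▸ Real.sq_sqrt (by positivity)
  have hs₁₃ : l₁₃ ^ 2 = r₁ ^ 2 + r₃ ^ 2 + 2 * I * r₁ * r₃ :=
    hl₁₃ ▸ Real.sq_sqrt (by positivity)
  have hs₂₃ : l₂₃ ^ 2 = r₂ ^ 2 + r₃ ^ 2 + 2 * I * r₂ * r₃ :=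
    hl₂₃ ▸ Real.sq_sqrt (by positivity)
  obtain ⟨a₁, b₁, c₁⟩ :=
    sides_comparable_of_angle_mem hp₁₂ hp₁₃ hθ₁ (by linarith [hb₁.1]) hb₁.2
  obtain ⟨a₂, b₂, c₂⟩ :=
    sides_comparable_of_angle_mem hp₁₂ hp₂₃ hθ₂ (by linarith [hb₂.1]) hb₂.2
  obtain ⟨a₃, b₃, c₃⟩ :=
    sides_comparable_of_angle_mem hp₁₃ hp₂₃ hθ₃ (by linarith [hb₃.1]) hb₃.2
  simp only [hs₁₂, hs₁₃, hs₂₃] at a₁ b₁ c₁ a₂ b₂ c₂ a₃ b₃ c₃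
  obtain ⟨h₁₃, h₂₃⟩ := le_twenty_mul_of_side_comparable hI hr₁ hr₂ hr₃
    (by linarith) (by linarith) (by linarith)
  obtain ⟨h₁₂, h₃₂⟩ := le_twenty_mul_of_side_comparable hI hr₁ hr₃ hr₂
    (by linarith) (by linarith) (by linarith)
  obtain ⟨h₂₁, h₃₁⟩ := le_twenty_mul_of_side_comparable hI hr₂ hr₃ hr₁
    (by linarith) (by linarith) (by linarith)
  exact ⟨h₁₂, h₂₁, h₁₃, h₃₁, h₂₃, h₃₂⟩
end

section
/- Let v₁v₂v₃ be a triangle with constant weight I > 1 on all three edges and radii r₁, r₂, r₃ > 0 generating a non-degenerate triangle. There exist constants θ₀ = θ₀(I) ∈ (0, π/6), C = C(I) > 0 and M = M(I) > 0, depending only on I, such that if all three inner angles lie in [π/6 − θ₀, π/2 + θ₀], then C ≤ h_{ij,k}/l_{ij} ≤ M for every choice of distinct indices {i, j, k} = {1, 2, 3}. -/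
/-- An edge of inversive distance `I` is at least the sum of its radii; its square is the
radicand. -/
lemma sqrt_edge_bounds {I x y : ℝ} (hI : 1 < I) (hx : 0 < x) (hy : 0 < y) :
    x + y ≤ √(x ^ 2 + y ^ 2 + 2 * I * x * y) ∧
      √(x ^ 2 + y ^ 2 + 2 * I * x * y) ^ 2 = x ^ 2 + y ^ 2 + 2 * I * x * y := by
  have hxy := mul_pos hx hy
  refine ⟨Real.le_sqrt_of_sq_le ?_, Real.sq_sqrt ?_⟩
  · nlinarith
  · have : 0 < I := by linarith
    positivity

lemma edge_sq_le {I x y m : ℝ} (hI : 1 < I) (hx : 0 < x) (hy : 0 < y) (hxm : x ≤ m)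
    (hym : y ≤ m) : x ^ 2 + y ^ 2 + 2 * I * x * y ≤ 2 * (1 + I) * m ^ 2 := by
  have h1 : x ^ 2 ≤ m ^ 2 := by gcongr
  have h2 : y ^ 2 ≤ m ^ 2 := by gcongr
  have h3 : x * y ≤ m ^ 2 := by nlinarith
  nlinarith

lemma bounds_of_arccos_mem {α β t : ℝ} (hα : 0 < α) (hβ : β < Real.pi)
    (h₁ : α ≤ Real.arccos t) (h₂ : Real.arccos t ≤ β) :
    Real.cos β ≤ t ∧ t ≤ Real.cos α := by
  have ht1 : -1 ≤ t := by
    by_contra! h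
    rw [Real.arccos_of_le_neg_one h.le] at h₂
    linarith
  have ht2 : t ≤ 1 := by
    by_contra! h
    rw [Real.arccos_of_one_le h.le] at h₁
    linarith
  have ht := Real.cos_arccos ht1 ht2
  have h0 := Real.arccos_le_pi t
  exact ⟨ht ▸ Real.cos_le_cos_of_nonneg_of_le_pi (by linarith) hβ.le h₂,
    ht ▸ Real.cos_le_cos_of_nonneg_of_le_pi hα.le h0 h₁⟩

/-- The factor of `h_{ij,k}` carrying its sign is bounded below when the angle at `v_k` is not
too obtuse. -/
lemma mul_le_of_cos_ge {I x y z a b : ℝ} (hI : 1 < I) (hx : 0 < x) (hy : 0 < y) (hz : 0 < z)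
    (ha2 : a ^ 2 = x ^ 2 + z ^ 2 + 2 * I * x * z) (hb2 : b ^ 2 = y ^ 2 + z ^ 2 + 2 * I * y * z)
    (hc : -(1 / (4 * (1 + I))) * (a * b) ≤ z ^ 2 + I * z * (x + y) - I * x * y) :
    x * y / 4 ≤ I * z * (x + y) - (I - 1) * (x * y) := by
  have hxy := mul_pos hx hy
  rcases le_total (x * y) (z * (x + y)) with h | h
  · nlinarith
  · have hzx : z ≤ x := by nlinarith [mul_pos hz hx]
    have hzy : z ≤ y := by nlinarith [mul_pos hz hy]
    have hz4 : 4 * z ^ 2 ≤ x * y := by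
      have h1 : (z * (x + y)) ^ 2 ≤ (x * y) ^ 2 := by gcongr
      have h2 : 4 * (x * y) ≤ (x + y) ^ 2 := by nlinarith [sq_nonneg (x - y)]
      have h3 : z ^ 2 * (4 * (x * y)) ≤ z ^ 2 * (x + y) ^ 2 := by gcongr
      have h4 : (4 * z ^ 2) * (x * y) ≤ (x * y) * (x * y) := by nlinarith
      exact le_of_mul_le_mul_right h4 hxy
    have hab : a * b ≤ 2 * (1 + I) * (x * y) := by
      refine le_of_sq_le_sq ?_ (by positivity)
      calc (a * b) ^ 2 = a ^ 2 * b ^ 2 := by ring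
        _ ≤ (2 * (1 + I) * x ^ 2) * (2 * (1 + I) * y ^ 2) := by
          rw [ha2, hb2]
          have := edge_sq_le hI hx hz le_rfl hzx
          have := edge_sq_le hI hy hz le_rfl hzy
          have : 0 < I := by linarith
          gcongr
        _ = _ := by ring
    have h5 : 1 / (4 * (1 + I)) * (a * b) ≤ x * y / 2 := by
      rw [div_mul_eq_mul_div, div_le_iff₀ (by linarith)]
      linarith
    linarith

/-- A lower bound on the angle at `v_i` prevents `r_i` from dominating both other radii. -/
lemma radius_le_of_cos_le {I x y z m a b c : ℝ} (hI : 1 < I) (hx : 0 < x) (hy : 0 < y)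
    (hz : 0 < z)
    (ha2 : a ^ 2 = x ^ 2 + y ^ 2 + 2 * I * x * y) (hb2 : b ^ 2 = x ^ 2 + z ^ 2 + 2 * I * x * z)
    (hc0 : 0 ≤ c) (hc1 : c < 1) (hym : y ≤ m) (hzm : z ≤ m)
    (hc : x ^ 2 + I * x * (y + z) - I * y * z ≤ c * (a * b)) :
    x ≤ (1 + 2 * I) / (1 - c) * m := by
  have hm : 0 < m := hy.trans_le hym
  rw [div_mul_eq_mul_div, le_div_iff₀ (by linarith)]
  rcases le_total x m with h | h
  · nlinarith [mul_nonneg hx.le hc0, mul_pos hm (by linarith : 0 < I)]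
  · have hedge : ∀ w, 0 < w → w ≤ m →
        x ^ 2 + w ^ 2 + 2 * I * x * w ≤ x ^ 2 + (1 + 2 * I) * (x * m) := by
      intro w hw hwm
      have h1 : x * w ≤ x * m := by gcongr
      have h2 : w ^ 2 ≤ x * m := by nlinarith
      nlinarith
    have hab : a * b ≤ x ^ 2 + (1 + 2 * I) * (x * m) := by
      nlinarith [hedge y hy hym, hedge z hz hzm, sq_nonneg (a - b)]
    have h3 : y * z ≤ x * (y + z) := by nlinarith [mul_pos hx hz]
    have h4 : c * (a * b) ≤ c * (x ^ 2 + (1 + 2 * I) * (x * m)) := by gcongr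
    have h5 : c * ((1 + 2 * I) * (x * m)) ≤ (1 + 2 * I) * (x * m) :=
      mul_le_of_le_one_left (by positivity) hc1.le
    have h6 : x * (x * (1 - c)) ≤ x * ((1 + 2 * I) * m) := by nlinarith
    exact le_of_mul_le_mul_left h6 hx

lemma min_le_of_mul_le {I x y z : ℝ} (hI : 1 < I) (hx : 0 < x) (hy : 0 < y)
    (h : x * y / 4 ≤ I * z * (x + y) - (I - 1) * (x * y)) : min x y ≤ 8 * z := by
  have hxy := mul_pos hx hy
  have h₁ : I * (x * y) ≤ I * (4 * (z * (x + y))) := by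
    linarith [mul_pos (sub_pos.2 hI) hxy]
  have h₂ : x * y ≤ 4 * (z * (x + y)) := le_of_mul_le_mul_left h₁ (by linarith)
  rcases le_total x y with h | h
  · rw [min_eq_left h]
    nlinarith
  · rw [min_eq_right h]
    nlinarith

lemma max_le_of_min_le {K x y z : ℝ} (hK : 1 ≤ K) (hx : 0 < x) (hy : 0 < y) (hz : 0 < z)
    (h₁ : min x y ≤ 8 * z) (h₂ : min x z ≤ 8 * y) (h₃ : min y z ≤ 8 * x)
    (k₁ : x ≤ K * max y z) (k₂ : y ≤ K * max x z) (k₃ : z ≤ K * max x y) :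
    max x (max y z) ≤ 8 * K * x ∧ max x (max y z) ≤ 8 * K * y ∧ max x (max y z) ≤ 8 * K * z := by
  rcases le_total x y with a | a <;> rcases le_total x z with b | b <;>
    rcases le_total y z with c | c <;> simp only [max_eq_left, max_eq_right, min_eq_left,
      min_eq_right, a, b, c] at * <;> refine ⟨?_, ?_, ?_⟩ <;> nlinarith

/-- Both bounds on the quotient `h_{ij,k} / l_{ij}`, given comparability of the radii. -/
lemma quotient_bounds {I x y z l A P N L R s m : ℝ} (hI : 1 < I) (hx : 0 < x) (hy : 0 < y)
    (hs : 0 < s) (hR : 0 < R) (hm : 0 < m) (hl : 0 < l) (hP : 0 < P)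
    (hl2 : l ^ 2 = x ^ 2 + y ^ 2 + 2 * I * x * y) (hL : L = (1 + I) * (x * y) * N)
    (hNdef : N = I * z * (x + y) - (I - 1) * (x * y))
    (hN : x * y / 4 ≤ N) (hNP : z * (x + y) ≤ 2 * P)
    (hA1 : s * P ≤ A) (hA2 : A ≤ P) (hPm : P ≤ 2 * (1 + I) * m ^ 2)
    (hxm : x ≤ m) (hym : y ≤ m) (hxR : m ≤ R * x) (hyR : m ≤ R * y) :
    1 / (16 * (1 + I) * R ^ 4) ≤ L / (A * l) / l ∧ L / (A * l) / l ≤ (1 + I) * I / s := by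
  have hA : 0 < A := (mul_pos hs hP).trans_le hA1
  have hxy := mul_pos hx hy
  have hI0 : 0 < I := by linarith
  have hAm : A ≤ 2 * (1 + I) * m ^ 2 := hA2.trans hPm
  have hlm : l ^ 2 ≤ 2 * (1 + I) * m ^ 2 := hl2 ▸ edge_sq_le hI hx hy hxm hym
  have hmR : m ^ 2 ≤ R ^ 2 * (x * y) := by
    calc m ^ 2 = m * m := sq m
      _ ≤ (R * x) * (R * y) := by gcongr
      _ = _ := by ring
  rw [div_div, mul_assoc A, ← sq]
  constructor
  · rw [div_le_div_iff₀ (by positivity) (by positivity), one_mul]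
    calc A * l ^ 2 ≤ (2 * (1 + I) * m ^ 2) * (2 * (1 + I) * m ^ 2) := by gcongr
      _ = 4 * (1 + I) ^ 2 * (m ^ 2 * m ^ 2) := by ring
      _ ≤ 4 * (1 + I) ^ 2 * ((R ^ 2 * (x * y)) * (R ^ 2 * (x * y))) := by gcongr
      _ = (1 + I) * (x * y) * (x * y / 4) * (16 * (1 + I) * R ^ 4) := by ring
      _ ≤ (1 + I) * (x * y) * N * (16 * (1 + I) * R ^ 4) := by gcongr
      _ = _ := by rw [hL]
  · rw [div_le_div_iff₀ (by positivity) hs]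
    have hN2 : N ≤ 2 * I * P := by
      have : I * (z * (x + y)) ≤ I * (2 * P) := by gcongr
      nlinarith
    have hxyl : 2 * (x * y) ≤ l ^ 2 := by nlinarith [sq_nonneg x, sq_nonneg y]
    calc L * s = (1 + I) * (x * y) * N * s := by rw [hL]
      _ ≤ (1 + I) * (x * y) * (2 * I * P) * s := by gcongr
      _ = (1 + I) * I * ((s * P) * (2 * (x * y))) := by ring
      _ ≤ (1 + I) * I * (A * l ^ 2) := by gcongr

lemma sin_le_sin_of_mem {α t : ℝ} (hα : 0 < α) (h₁ : α ≤ t) (h₂ : t ≤ Real.pi - α) :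
    Real.sin α ≤ Real.sin t := by
  rcases le_total t (Real.pi / 2) with h | h
  · exact Real.sin_le_sin_of_le_of_le_pi_div_two (by linarith) h h₁
  · rw [← Real.sin_pi_sub t]
    exact Real.sin_le_sin_of_le_of_le_pi_div_two (by linarith) (by linarith) (by linarith)

/-- Angle bounds at the vertex of radius `x`, in terms of the numerator of the law of cosines. -/
lemma cos_numerator_bounds {I x y z a b d θ θ₀ : ℝ} (hθ₀ : 0 < θ₀)
    (hθ₀' : θ₀ ≤ 1 / (4 * (1 + I))) (hθ₆ : θ₀ < Real.pi / 6) (ha : 0 < a) (hb : 0 < b)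
    (ha2 : a ^ 2 = x ^ 2 + y ^ 2 + 2 * I * x * y) (hb2 : b ^ 2 = x ^ 2 + z ^ 2 + 2 * I * x * z)
    (hd2 : d ^ 2 = y ^ 2 + z ^ 2 + 2 * I * y * z)
    (hθ : θ = Real.arccos ((a ^ 2 + b ^ 2 - d ^ 2) / (2 * a * b)))
    (hmem : Real.pi / 6 - θ₀ ≤ θ ∧ θ ≤ Real.pi / 2 + θ₀) :
    -(1 / (4 * (1 + I))) * (a * b) ≤ x ^ 2 + I * x * (y + z) - I * y * z ∧
      x ^ 2 + I * x * (y + z) - I * y * z ≤ Real.cos (Real.pi / 6 - θ₀) * (a * b) := by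
  have hab := mul_pos ha hb
  rw [hθ] at hmem
  obtain ⟨h₁, h₂⟩ := bounds_of_arccos_mem (by linarith) (by linarith [Real.pi_pos])
    hmem.1 hmem.2
  have ht : (a ^ 2 + b ^ 2 - d ^ 2) / (2 * a * b) =
      (x ^ 2 + I * x * (y + z) - I * y * z) / (a * b) := by
    rw [ha2, hb2, hd2, div_eq_div_iff (by positivity) hab.ne']
    ring
  rw [ht] at h₁ h₂
  rw [add_comm, Real.cos_add_pi_div_two] at h₁
  refine ⟨(le_div_iff₀ hab).1 (le_trans ?_ h₁), (div_le_iff₀ hab).1 h₂⟩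
  have := Real.sin_le hθ₀.le
  linarith

lemma sq_mul_curvature_eq {I x y z : ℝ} (hx : x ≠ 0) (hy : y ≠ 0) (hz : z ≠ 0) :
    x ^ 2 * y ^ 2 * z ^ 2 * (1 / z * (1 / z * (1 - I ^ 2) + (I + I ^ 2) * (1 / x + 1 / y))) =
      (1 + I) * (x * y) * (I * z * (x + y) - (I - 1) * (x * y)) := by
  field_simp
  ring


/-- Lemma 5.5(b): for a non-degenerate inversive distance circle packing triangle
with constant weight `I > 1`, there exist `θ₀ = θ₀(I) ∈ (0, π/6)` and constants
`C = C(I) > 0`, `M = M(I) > 0` such that if all three inner angles lie in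
`[π/6 − θ₀, π/2 + θ₀]`, then `C ≤ h_{ij,k}/l_{ij} ≤ M` for all distinct indices. -/
theorem stmt_18 (I : ℝ) (hI : 1 < I) :
    ∃ θ₀ C M : ℝ, 0 < θ₀ ∧ θ₀ < Real.pi / 6 ∧ 0 < C ∧ 0 < M ∧
      ∀ r₁ r₂ r₃ l₁₂ l₁₃ l₂₃ θ₁ θ₂ θ₃ κ₁ κ₂ κ₃ h₁ h₂ h₃ A : ℝ,
        0 < r₁ → 0 < r₂ → 0 < r₃ →
        l₁₂ = Real.sqrt (r₁ ^ 2 + r₂ ^ 2 + 2 * I * r₁ * r₂) →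
        l₁₃ = Real.sqrt (r₁ ^ 2 + r₃ ^ 2 + 2 * I * r₁ * r₃) →
        l₂₃ = Real.sqrt (r₂ ^ 2 + r₃ ^ 2 + 2 * I * r₂ * r₃) →
        (l₁₂ < l₁₃ + l₂₃ ∧ l₁₃ < l₁₂ + l₂₃ ∧ l₂₃ < l₁₂ + l₁₃) →
        θ₁ = Real.arccos ((l₁₂ ^ 2 + l₁₃ ^ 2 - l₂₃ ^ 2) / (2 * l₁₂ * l₁₃)) →
        θ₂ = Real.arccos ((l₁₂ ^ 2 + l₂₃ ^ 2 - l₁₃ ^ 2) / (2 * l₁₂ * l₂₃)) →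
        θ₃ = Real.arccos ((l₁₃ ^ 2 + l₂₃ ^ 2 - l₁₂ ^ 2) / (2 * l₁₃ * l₂₃)) →
        κ₁ = 1 / r₁ → κ₂ = 1 / r₂ → κ₃ = 1 / r₃ →
        h₁ = κ₁ * (1 - I ^ 2) + (I + I ^ 2) * (κ₂ + κ₃) →
        h₂ = κ₂ * (1 - I ^ 2) + (I + I ^ 2) * (κ₁ + κ₃) →
        h₃ = κ₃ * (1 - I ^ 2) + (I + I ^ 2) * (κ₁ + κ₂) →
        A = l₁₂ * l₁₃ * Real.sin θ₁ →
        (Real.pi / 6 - θ₀ ≤ θ₁ ∧ θ₁ ≤ Real.pi / 2 + θ₀) →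
        (Real.pi / 6 - θ₀ ≤ θ₂ ∧ θ₂ ≤ Real.pi / 2 + θ₀) →
        (Real.pi / 6 - θ₀ ≤ θ₃ ∧ θ₃ ≤ Real.pi / 2 + θ₀) →
        (C ≤ r₁ ^ 2 * r₂ ^ 2 * r₃ ^ 2 * (κ₃ * h₃) / (A * l₁₂) / l₁₂ ∧
            r₁ ^ 2 * r₂ ^ 2 * r₃ ^ 2 * (κ₃ * h₃) / (A * l₁₂) / l₁₂ ≤ M) ∧
        (C ≤ r₁ ^ 2 * r₂ ^ 2 * r₃ ^ 2 * (κ₂ * h₂) / (A * l₁₃) / l₁₃ ∧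
            r₁ ^ 2 * r₂ ^ 2 * r₃ ^ 2 * (κ₂ * h₂) / (A * l₁₃) / l₁₃ ≤ M) ∧
        (C ≤ r₁ ^ 2 * r₂ ^ 2 * r₃ ^ 2 * (κ₁ * h₁) / (A * l₂₃) / l₂₃ ∧
            r₁ ^ 2 * r₂ ^ 2 * r₃ ^ 2 * (κ₁ * h₁) / (A * l₂₃) / l₂₃ ≤ M) := by
  obtain ⟨θ₀, hθ₀⟩ : ∃ θ₀, θ₀ = 1 / (4 * (1 + I)) := ⟨_, rfl⟩
  have hθpos : 0 < θ₀ := by rw [hθ₀]; positivity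
  have hθ6 : θ₀ < Real.pi / 6 := by
    have : θ₀ ≤ 1 / 8 := by
      rw [hθ₀]
      exact one_div_le_one_div_of_le (by norm_num) (by linarith)
    linarith [Real.pi_gt_three]
  obtain ⟨c, hc⟩ : ∃ c, c = Real.cos (Real.pi / 6 - θ₀) := ⟨_, rfl⟩
  obtain ⟨s, hs⟩ : ∃ s, s = Real.sin (Real.pi / 6 - θ₀) := ⟨_, rfl⟩
  have hs0 : 0 < s := hs ▸ Real.sin_pos_of_pos_of_lt_pi (by linarith) (by linarith)
  have hc0 : 0 ≤ c := hc ▸ Real.cos_nonneg_of_mem_Icc ⟨by linarith, by linarith⟩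
  have hc1 : c < 1 := by
    have := Real.sin_sq_add_cos_sq (Real.pi / 6 - θ₀)
    rw [← hc, ← hs] at this
    nlinarith
  obtain ⟨K, hK⟩ : ∃ K, K = (1 + 2 * I) / (1 - c) := ⟨_, rfl⟩
  have hK1 : 1 ≤ K := by
    rw [hK, le_div_iff₀ (by linarith)]
    linarith
  refine ⟨θ₀, 1 / (16 * (1 + I) * (8 * K) ^ 4), (1 + I) * I / s, hθpos, hθ6, by positivity,
    by positivity, ?_⟩
  intro x y z a b d θ₁ θ₂ θ₃ κ₁ κ₂ κ₃ h₁ h₂ h₃ A hx hy hz ha hb hd _ hθ₁ hθ₂ hθ₃ hκ₁ hκ₂ hκ₃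
    hh₁ hh₂ hh₃ hA m₁ m₂ m₃
  obtain ⟨la, ha2⟩ := sqrt_edge_bounds hI hx hy
  obtain ⟨lb, hb2⟩ := sqrt_edge_bounds hI hx hz
  obtain ⟨ld, hd2⟩ := sqrt_edge_bounds hI hy hz
  rw [← ha] at la ha2
  rw [← hb] at lb hb2
  rw [← hd] at ld hd2
  have ha0 : 0 < a := by linarith only [la, hx, hy]
  have hb0 : 0 < b := by linarith only [lb, hx, hz]
  have hd0 : 0 < d := by linarith only [ld, hy, hz]
  have ha2' : a ^ 2 = y ^ 2 + x ^ 2 + 2 * I * y * x := by rw [ha2]; ring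
  have hb2' : b ^ 2 = z ^ 2 + x ^ 2 + 2 * I * z * x := by rw [hb2]; ring
  have hd2' : d ^ 2 = z ^ 2 + y ^ 2 + 2 * I * z * y := by rw [hd2]; ring
  obtain ⟨p₁, q₁⟩ := cos_numerator_bounds hθpos hθ₀.le hθ6 ha0 hb0 ha2 hb2 hd2 hθ₁ m₁
  obtain ⟨p₂, q₂⟩ := cos_numerator_bounds hθpos hθ₀.le hθ6 ha0 hd0 ha2' hd2 hb2 hθ₂ m₂
  obtain ⟨p₃, q₃⟩ := cos_numerator_bounds hθpos hθ₀.le hθ6 hb0 hd0 hb2' hd2' ha2 hθ₃ m₃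
  have n₁ := mul_le_of_cos_ge hI hy hz hx ha2' hb2' p₁
  have n₂ := mul_le_of_cos_ge hI hx hz hy ha2 hd2' p₂
  have n₃ := mul_le_of_cos_ge hI hx hy hz hb2 hd2 p₃
  rw [← hc] at q₁ q₂ q₃
  have k₁ := radius_le_of_cos_le hI hx hy hz ha2 hb2 hc0 hc1
    (le_max_left y z) (le_max_right y z) q₁
  have k₂ := radius_le_of_cos_le hI hy hx hz ha2' hd2 hc0 hc1
    (le_max_left x z) (le_max_right x z) q₂
  have k₃ := radius_le_of_cos_le hI hz hx hy hb2' hd2' hc0 hc1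
    (le_max_left x y) (le_max_right x y) q₃
  rw [← hK] at k₁ k₂ k₃
  obtain ⟨Rx, Ry, Rz⟩ := max_le_of_min_le hK1 hx hy hz (min_le_of_mul_le hI hx hy n₃)
    (min_le_of_mul_le hI hx hz n₂) (min_le_of_mul_le hI hy hz n₁) k₁ k₂ k₃
  obtain ⟨m, hm⟩ : ∃ m, m = max x (max y z) := ⟨_, rfl⟩
  rw [← hm] at Rx Ry Rz
  have xm : x ≤ m := hm ▸ le_max_left _ _
  have ym : y ≤ m := hm ▸ (le_max_left _ _).trans (le_max_right _ _)
  have zm : z ≤ m := hm ▸ (le_max_right _ _).trans (le_max_right _ _)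
  have hm0 : 0 < m := hx.trans_le xm
  have hab := mul_pos ha0 hb0
  have hA1 : s * (a * b) ≤ A := by
    have := sin_le_sin_of_mem (by linarith only [hθ6]) m₁.1
      (by linarith only [m₁.2, Real.pi_pos])
    rw [hA, hs, mul_comm]
    gcongr
  have hA2 : A ≤ a * b := by
    rw [hA]
    exact mul_le_of_le_one_right hab.le (Real.sin_le_one _)
  have hPm : a * b ≤ 2 * (1 + I) * m ^ 2 := by
    have ham := ha2 ▸ edge_sq_le hI hx hy xm ym
    have hbm := hb2 ▸ edge_sq_le hI hx hz xm zm
    linarith only [ham, hbm, two_mul_le_add_sq a b]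
  have xa : x ≤ a := by linarith only [la, hy]
  have xb : x ≤ b := by linarith only [lb, hz]
  have ya : y ≤ a := by linarith only [la, hx]
  have zb : z ≤ b := by linarith only [lb, hx]
  have hxy : x * y ≤ a * b := by
    rw [mul_comm]
    gcongr
  have hxz : x * z ≤ a * b := by gcongr
  have hyz : y * z ≤ a * b := by gcongr
  have hKR : 0 < 8 * K := by linarith only [hK1]
  have e₃ : x ^ 2 * y ^ 2 * z ^ 2 * (κ₃ * h₃) =
      (1 + I) * (x * y) * (I * z * (x + y) - (I - 1) * (x * y)) := by
    rw [hh₃, hκ₁, hκ₂, hκ₃, ← sq_mul_curvature_eq hx.ne' hy.ne' hz.ne']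
  have e₂ : x ^ 2 * y ^ 2 * z ^ 2 * (κ₂ * h₂) =
      (1 + I) * (x * z) * (I * y * (x + z) - (I - 1) * (x * z)) := by
    rw [hh₂, hκ₁, hκ₂, hκ₃, ← sq_mul_curvature_eq hx.ne' hz.ne' hy.ne']
    ring
  have e₁ : x ^ 2 * y ^ 2 * z ^ 2 * (κ₁ * h₁) =
      (1 + I) * (y * z) * (I * x * (y + z) - (I - 1) * (y * z)) := by
    rw [hh₁, hκ₁, hκ₂, hκ₃, ← sq_mul_curvature_eq hy.ne' hz.ne' hx.ne']
    ring
  exact ⟨quotient_bounds hI hx hy hs0 hKR hm0 ha0 hab ha2 e₃ rfl n₃ (by linarith only [hxz, hyz])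
      hA1 hA2 hPm xm ym Rx Ry,
    quotient_bounds hI hx hz hs0 hKR hm0 hb0 hab hb2 e₂ rfl n₂ (by linarith only [hxy, hyz])
      hA1 hA2 hPm xm zm Rx Rz,
    quotient_bounds hI hy hz hs0 hKR hm0 hd0 hab hd2 e₁ rfl n₁ (by linarith only [hxy, hxz])
      hA1 hA2 hPm ym zm Ry Rz⟩
end

section
/- Let v₁v₂v₃ be a triangle with constant weight I > 1 on all three edges and radii r₁, r₂, r₃ > 0 generating a non-degenerate triangle, and set θ₀ = min{π/1000, arcsin(1/(10(20 + I)))}. If all three inner angles lie in [π/6 − θ₀, π/2 + θ₀], then for each index k (with {i, j, k} = {1, 2, 3}) one has r_k h_k = (1 + I)(1 + I(r_k/r_i + r_k/r_j − 1)) ≥ (1 + I)/4 > 0. -/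
/-- In a triangle of sides `p`, `q`, `s` generated by radii `a`, `b`, `c` with constant weight `I`,
an almost non-obtuse angle at the vertex of radius `a` bounds `I (1 - a / b - a / c)` from above. -/
theorem weight_mul_one_sub_radius_ratios_le {I a b c p q s : ℝ} (hI : 1 < I)
    (ha : 0 < a) (hb : 0 < b) (hc : 0 < c) (hp : 0 < p) (hq : 0 < q)
    (hp2 : p ^ 2 = a ^ 2 + b ^ 2 + 2 * I * a * b)
    (hq2 : q ^ 2 = a ^ 2 + c ^ 2 + 2 * I * a * c)
    (hs2 : s ^ 2 = b ^ 2 + c ^ 2 + 2 * I * b * c)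
    (hang : Real.arccos ((p ^ 2 + q ^ 2 - s ^ 2) / (2 * p * q))
      ≤ Real.pi / 2 + Real.arcsin (1 / (10 * (20 + I)))) :
    I * (1 - a / b - a / c) ≤ 3 / 4 := by
  set ε : ℝ := 1 / (10 * (20 + I)) with hε
  have hε0 : 0 < ε := by positivity
  have hεI : ε * (10 * (20 + I)) = 1 := by rw [hε]; field_simp
  have hε1 : ε < 1 := by nlinarith
  have hcos : -((p ^ 2 + q ^ 2 - s ^ 2) / (2 * p * q)) ≤ ε := by
    have h : Real.arcsin (-((p ^ 2 + q ^ 2 - s ^ 2) / (2 * p * q))) ≤ Real.arcsin ε := by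
      rw [Real.arcsin_neg]
      rw [Real.arccos] at hang
      linarith
    rwa [Real.arcsin_le_iff_le_sin'
      ⟨Real.neg_pi_div_two_le_arcsin ε, Real.arcsin_lt_pi_div_two.2 hε1⟩,
      Real.sin_arcsin (by linarith) hε1.le] at h
  obtain ⟨x, rfl⟩ : ∃ x, a = x * b := ⟨a / b, by field_simp⟩
  obtain ⟨y, hy⟩ : ∃ y, x * b = y * c := ⟨x * b / c, by field_simp⟩
  obtain ⟨u, rfl⟩ : ∃ u, p = u * b := ⟨p / b, by field_simp⟩
  obtain ⟨v, rfl⟩ : ∃ v, q = v * c := ⟨q / c, by field_simp⟩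
  have hx : 0 < x := pos_of_mul_pos_left ha hb.le
  have hy0 : 0 < y := pos_of_mul_pos_left (hy ▸ ha) hc.le
  have hu : u ^ 2 = x ^ 2 + 1 + 2 * I * x := by
    have : b ^ 2 ≠ 0 := by positivity
    apply mul_right_cancel₀ this
    linear_combination hp2
  have hv : v ^ 2 = y ^ 2 + 1 + 2 * I * y := by
    have : c ^ 2 ≠ 0 := by positivity
    apply mul_right_cancel₀ this
    rw [hy] at hq2
    linear_combination hq2
  have hnum : (u * b) ^ 2 + (v * c) ^ 2 - s ^ 2 = 2 * (x * y + I * (x + y) - I) * (b * c) := by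
    rw [hp2, hq2, hs2]
    linear_combination (2 * x * b + 2 * I * b) * hy
  rw [hnum, ← neg_div, div_le_iff₀ (by positivity)] at hcos
  have key : I * (1 - x - y) ≤ x * y + ε * (u * v) := by
    have hbc : 0 < b * c := by positivity
    refine le_of_mul_le_mul_right ?_ hbc
    linarith
  rw [hy, mul_div_cancel_right₀ _ hc.ne', ← hy, mul_div_cancel_right₀ _ hb.ne']
  rcases le_or_gt 1 (x + y) with h | h
  · nlinarith
  · have huv : u * v ≤ 5 * (20 + I) := by nlinarith [sq_nonneg (u - v)]
    nlinarith [sq_nonneg (x - y), mul_le_mul_of_nonneg_left huv hε0.le]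

theorem radius_mul_weighted_curvature {I a b c : ℝ} (ha : a ≠ 0) :
    a * (1 / a * (1 - I ^ 2) + (I + I ^ 2) * (1 / b + 1 / c))
      = (1 + I) * (1 + I * (a / b + a / c - 1)) := by
  linear_combination (1 - I ^ 2) * mul_one_div_cancel ha

theorem quarter_le_of_weight_mul_le {I x y : ℝ} (hI : 1 < I) (h : I * (1 - x - y) ≤ 3 / 4) :
    (1 + I) / 4 ≤ (1 + I) * (1 + I * (x + y - 1)) := by
  rw [div_eq_mul_inv]
  exact mul_le_mul_of_nonneg_left (by linarith) (by linarith)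

/-- Inequality (5.7): with `θ₀ = min{π/1000, arcsin(1/(10(20 + I)))}`, if the
three inner angles of a non-degenerate inversive distance circle packing
triangle with constant weight `I > 1` lie in `[π/6 − θ₀, π/2 + θ₀]`, then for
each `k` one has `r_k h_k = (1 + I)(1 + I(r_k/r_i + r_k/r_j − 1)) ≥ (1 + I)/4 > 0`. -/
theorem stmt_19 (I : ℝ) (hI : 1 < I)
    (θ₀ : ℝ) (hθ₀ : θ₀ = min (Real.pi / 1000) (Real.arcsin (1 / (10 * (20 + I)))))
    (r₁ r₂ r₃ l₁₂ l₁₃ l₂₃ θ₁ θ₂ θ₃ κ₁ κ₂ κ₃ h₁ h₂ h₃ : ℝ)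
    (hr₁ : 0 < r₁) (hr₂ : 0 < r₂) (hr₃ : 0 < r₃)
    (hl₁₂ : l₁₂ = Real.sqrt (r₁ ^ 2 + r₂ ^ 2 + 2 * I * r₁ * r₂))
    (hl₁₃ : l₁₃ = Real.sqrt (r₁ ^ 2 + r₃ ^ 2 + 2 * I * r₁ * r₃))
    (hl₂₃ : l₂₃ = Real.sqrt (r₂ ^ 2 + r₃ ^ 2 + 2 * I * r₂ * r₃))
    (hadm : l₁₂ < l₁₃ + l₂₃ ∧ l₁₃ < l₁₂ + l₂₃ ∧ l₂₃ < l₁₂ + l₁₃)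
    (hθ₁ : θ₁ = Real.arccos ((l₁₂ ^ 2 + l₁₃ ^ 2 - l₂₃ ^ 2) / (2 * l₁₂ * l₁₃)))
    (hθ₂ : θ₂ = Real.arccos ((l₁₂ ^ 2 + l₂₃ ^ 2 - l₁₃ ^ 2) / (2 * l₁₂ * l₂₃)))
    (hθ₃ : θ₃ = Real.arccos ((l₁₃ ^ 2 + l₂₃ ^ 2 - l₁₂ ^ 2) / (2 * l₁₃ * l₂₃)))
    (hκ₁ : κ₁ = 1 / r₁) (hκ₂ : κ₂ = 1 / r₂) (hκ₃ : κ₃ = 1 / r₃)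
    (hh₁ : h₁ = κ₁ * (1 - I ^ 2) + (I + I ^ 2) * (κ₂ + κ₃))
    (hh₂ : h₂ = κ₂ * (1 - I ^ 2) + (I + I ^ 2) * (κ₁ + κ₃))
    (hh₃ : h₃ = κ₃ * (1 - I ^ 2) + (I + I ^ 2) * (κ₁ + κ₂))
    (hang₁ : Real.pi / 6 - θ₀ ≤ θ₁ ∧ θ₁ ≤ Real.pi / 2 + θ₀)
    (hang₂ : Real.pi / 6 - θ₀ ≤ θ₂ ∧ θ₂ ≤ Real.pi / 2 + θ₀)
    (hang₃ : Real.pi / 6 - θ₀ ≤ θ₃ ∧ θ₃ ≤ Real.pi / 2 + θ₀) :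
    (r₁ * h₁ = (1 + I) * (1 + I * (r₁ / r₂ + r₁ / r₃ - 1)) ∧ (1 + I) / 4 ≤ r₁ * h₁) ∧
    (r₂ * h₂ = (1 + I) * (1 + I * (r₂ / r₁ + r₂ / r₃ - 1)) ∧ (1 + I) / 4 ≤ r₂ * h₂) ∧
    (r₃ * h₃ = (1 + I) * (1 + I * (r₃ / r₁ + r₃ / r₂ - 1)) ∧ (1 + I) / 4 ≤ r₃ * h₃) ∧
    0 < (1 + I) / 4 := by
  have hθ : θ₀ ≤ Real.arcsin (1 / (10 * (20 + I))) := hθ₀ ▸ min_le_right _ _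
  have hp₁₂ : 0 < l₁₂ := by rw [hl₁₂]; positivity
  have hp₁₃ : 0 < l₁₃ := by rw [hl₁₃]; positivity
  have hp₂₃ : 0 < l₂₃ := by rw [hl₂₃]; positivity
  have hs₁₂ : l₁₂ ^ 2 = r₁ ^ 2 + r₂ ^ 2 + 2 * I * r₁ * r₂ := by
    rw [hl₁₂]; exact Real.sq_sqrt (by positivity)
  have hs₁₃ : l₁₃ ^ 2 = r₁ ^ 2 + r₃ ^ 2 + 2 * I * r₁ * r₃ := by
    rw [hl₁₃]; exact Real.sq_sqrt (by positivity)
  have hs₂₃ : l₂₃ ^ 2 = r₂ ^ 2 + r₃ ^ 2 + 2 * I * r₂ * r₃ := by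
    rw [hl₂₃]; exact Real.sq_sqrt (by positivity)
  have bound₁ := weight_mul_one_sub_radius_ratios_le hI hr₁ hr₂ hr₃ hp₁₂ hp₁₃ hs₁₂ hs₁₃ hs₂₃
    (by linarith [hang₁.2])
  have bound₂ := weight_mul_one_sub_radius_ratios_le hI hr₂ hr₁ hr₃ hp₁₂ hp₂₃
    (by linarith) hs₂₃ hs₁₃ (by linarith [hang₂.2])
  have bound₃ := weight_mul_one_sub_radius_ratios_le hI hr₃ hr₁ hr₂ hp₁₃ hp₂₃
    (by linarith) (by linarith) hs₁₂ (by linarith [hang₃.2])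
  have eq₁ : r₁ * h₁ = (1 + I) * (1 + I * (r₁ / r₂ + r₁ / r₃ - 1)) := by
    rw [hh₁, hκ₁, hκ₂, hκ₃, radius_mul_weighted_curvature hr₁.ne']
  have eq₂ : r₂ * h₂ = (1 + I) * (1 + I * (r₂ / r₁ + r₂ / r₃ - 1)) := by
    rw [hh₂, hκ₁, hκ₂, hκ₃, radius_mul_weighted_curvature hr₂.ne']
  have eq₃ : r₃ * h₃ = (1 + I) * (1 + I * (r₃ / r₁ + r₃ / r₂ - 1)) := by
    rw [hh₃, hκ₁, hκ₂, hκ₃, radius_mul_weighted_curvature hr₃.ne']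
  refine ⟨⟨eq₁, ?_⟩, ⟨eq₂, ?_⟩, ⟨eq₃, ?_⟩, by positivity⟩
  · exact eq₁ ▸ quarter_le_of_weight_mul_le hI bound₁
  · exact eq₂ ▸ quarter_le_of_weight_mul_le hI bound₂
  · exact eq₃ ▸ quarter_le_of_weight_mul_le hI bound₃
end
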